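/- Assume (A3) and (A6), and let (f₋, f₊) be the unique solution of Luckock's equation. Then for each z ∈ Ī there exists a unique pair of bounded weight functions (w₋, w₊), with w₋ left-continuous of bounded variation, w₊ right-continuous of bounded variation, and w₋(I₋) = 0 = w₊(I₊), such that the associated linear functional F satisfies GF(X) = 1_{{M₋(X) ≤ z}} − f₋(z) for every configuration X; and likewise there exists a unique such pair of weight functions whose associated linear functional F satisfies GF(X) = 1_{{M₊(X) ≥ z}} − f₊(z) for every configuration X. -/

import Mathlib

open MeasureTheory Set
open scoped ENNReal

noncomputable section

/-- The right limit of `f` at `x`, with the convention `f(b+) := f b` at the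
right endpoint `b`. -/
def rLim (b : ℝ) (f : ℝ → ℝ) (x : ℝ) : ℝ :=
  if x < b then Function.rightLim f x else f b

/-- `ν` is the Lebesgue-Stieltjes signed measure `df` of `f` on the interval `[a,b]`,
with the conventions `f(a−) := f a` and `f(b+) := f b`. -/
def IsLS (a b : ℝ) (f : ℝ → ℝ) (ν : MeasureTheory.SignedMeasure ℝ) : Prop :=
  (∀ s : Set ℝ, MeasurableSet s → s ∩ Set.Icc a b = ∅ → ν s = 0) ∧
  (∀ x y : ℝ, a ≤ x → x ≤ y → y ≤ b → ν (Set.Ioc x y) = rLim b f y - rLim b f x) ∧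
  ν {a} = rLim b f a - f a

/-- The integral `∫_s g dν` of `g` over `s` against the signed measure `ν`. -/
def sInt (ν : MeasureTheory.SignedMeasure ℝ) (g : ℝ → ℝ) (s : Set ℝ) : ℝ :=
  (∫ x in s, g x ∂ν.toJordanDecomposition.posPart) -
    ∫ x in s, g x ∂ν.toJordanDecomposition.negPart

/-- Assumption (A3): `lm` (demand) is continuous and nonincreasing, `lp` (supply) is
continuous and nondecreasing on `[a,b]`; both are nonnegative. -/
def A3 (a b : ℝ) (lm lp : ℝ → ℝ) : Prop :=
  ContinuousOn lm (Set.Icc a b) ∧ ContinuousOn lp (Set.Icc a b) ∧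
  AntitoneOn lm (Set.Icc a b) ∧ MonotoneOn lp (Set.Icc a b) ∧
  (∀ x ∈ Set.Icc a b, 0 ≤ lm x) ∧ (∀ x ∈ Set.Icc a b, 0 ≤ lp x)

/-- Assumption (A6): the rates of market orders are positive. -/
def A6 (a b : ℝ) (lm lp : ℝ → ℝ) : Prop := 0 < lp a ∧ 0 < lm b

/-- `(fm, fp)` is a solution of Luckock's equation on `[a,b]` for demand/supply `lm, lp`:
both are continuous of bounded variation, `fm dlp + lm dfp = 0` and `fp dlm + lp dfm = 0`
as signed measures on `[a,b]`, and `fm b = 1 = fp a`. -/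
def LuckockSol (a b : ℝ) (lm lp fm fp : ℝ → ℝ) : Prop :=
  ContinuousOn fm (Set.Icc a b) ∧ ContinuousOn fp (Set.Icc a b) ∧
  BoundedVariationOn fm (Set.Icc a b) ∧ BoundedVariationOn fp (Set.Icc a b) ∧
  fm b = 1 ∧ fp a = 1 ∧
  ∀ νlm νlp νfm νfp : MeasureTheory.SignedMeasure ℝ,
    IsLS a b lm νlm → IsLS a b lp νlp → IsLS a b fm νfm → IsLS a b fp νfp →
    ∀ s : Set ℝ, MeasurableSet s →
      sInt νlp fm s + sInt νfp lm s = 0 ∧ sInt νlm fp s + sInt νfm lp s = 0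

/-- The state of the order book: the multiset of buy limit order prices and the
multiset of sell limit order prices. -/
structure OrderBook where
  minus : Multiset ℝ
  plus : Multiset ℝ

/-- A valid configuration on the interval `(a,b)`: all orders have prices in `(a,b)`
and every buy order is strictly below every sell order. -/
def IsConfig (a b : ℝ) (X : OrderBook) : Prop :=
  (∀ x ∈ X.minus, x ∈ Set.Ioo a b) ∧ (∀ x ∈ X.plus, x ∈ Set.Ioo a b) ∧
  ∀ x ∈ X.minus, ∀ y ∈ X.plus, x < y

/-- The best (highest) buy offer, `a` if there are no buy limit orders. -/
def Mminus (a : ℝ) (X : OrderBook) : ℝ := sSup (insert a {x | x ∈ X.minus})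

/-- The best (lowest) sell offer, `b` if there are no sell limit orders. -/
def Mplus (b : ℝ) (X : OrderBook) : ℝ := sInf (insert b {x | x ∈ X.plus})

open scoped Classical in
/-- The Luckock map for a buy order at price level `u` (`u = b` is a buy market order). -/
def Lminus (a b u : ℝ) (X : OrderBook) : OrderBook :=
  if X.plus ≠ 0 ∧ Mplus b X ≤ u then ⟨X.minus, X.plus.erase (Mplus b X)⟩
  else if u ∈ Set.Ioo a b then ⟨u ::ₘ X.minus, X.plus⟩ else X

open scoped Classical in
/-- The Luckock map for a sell order at price level `u` (`u = a` is a sell market order). -/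
def Lplus (a b u : ℝ) (X : OrderBook) : OrderBook :=
  if X.minus ≠ 0 ∧ u ≤ Mminus a X then ⟨X.minus.erase (Mminus a X), X.plus⟩
  else if u ∈ Set.Ioo a b then ⟨X.minus, u ::ₘ X.plus⟩ else X

/-- The linear functional associated with the weight functions `wm, wp`. -/
def linF (wm wp : ℝ → ℝ) (X : OrderBook) : ℝ :=
  (X.minus.map wm).sum + (X.plus.map wp).sum

/-- The generator of the Stigler-Luckock model with arrival measures `μm, μp`. -/
def genOp (a b : ℝ) (μm μp : MeasureTheory.Measure ℝ) (F : OrderBook → ℝ)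
    (X : OrderBook) : ℝ :=
  (∫ u, (F (Lminus a b u X) - F X) ∂μm) + ∫ u, (F (Lplus a b u X) - F X) ∂μp

/-- `μm` is the arrival measure of buy orders: `μm [x, b] = lm x`, supported on `[a,b]`. -/
def IsMuMinus (a b : ℝ) (lm : ℝ → ℝ) (μm : MeasureTheory.Measure ℝ) : Prop :=
  (∀ x ∈ Set.Icc a b, μm (Set.Icc x b) = ENNReal.ofReal (lm x)) ∧
  μm (Set.Icc a b)ᶜ = 0

/-- `μp` is the arrival measure of sell orders: `μp [a, x] = lp x`, supported on `[a,b]`. -/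
def IsMuPlus (a b : ℝ) (lp : ℝ → ℝ) (μp : MeasureTheory.Measure ℝ) : Prop :=
  (∀ x ∈ Set.Icc a b, μp (Set.Icc a x) = ENNReal.ofReal (lp x)) ∧
  μp (Set.Icc a b)ᶜ = 0

/-- An admissible pair of weight functions: bounded, of bounded variation, `wm`
left-continuous, `wp` right-continuous, with `wm a = 0` and `wp b = 0`. -/
def WPair (a b : ℝ) (wm wp : ℝ → ℝ) : Prop :=
  (∃ C, ∀ x ∈ Set.Icc a b, |wm x| ≤ C) ∧ (∃ C, ∀ x ∈ Set.Icc a b, |wp x| ≤ C) ∧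
  BoundedVariationOn wm (Set.Icc a b) ∧ BoundedVariationOn wp (Set.Icc a b) ∧
  (∀ x ∈ Set.Ioc a b, ContinuousWithinAt wm (Set.Iio x) x) ∧
  (∀ x ∈ Set.Ico a b, ContinuousWithinAt wp (Set.Ioi x) x) ∧
  wm a = 0 ∧ wp b = 0

section WeightFunctions

open Filter Topology

/-- On `[a,b]` the differential of `f` is `g dlm + h dlp`. -/
def HasLSDeriv (a b : ℝ) (lm lp f g h : ℝ → ℝ) : Prop :=
  ∃ σ : ℝ → ℝ, MonotoneOn σ (Icc a b) ∧ ∀ ε > 0, ∃ δ > 0, ∀ x ∈ Icc a b, ∀ y ∈ Icc a b,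
    x ≤ y → y - x < δ →
      |f y - f x - (g x * (lm y - lm x) + h x * (lp y - lp x))| ≤ ε * (σ y - σ x)

theorem ContinuousOn.exists_abs_le_Icc {a b : ℝ} {f : ℝ → ℝ} (hf : ContinuousOn f (Icc a b)) :
    ∃ C, 0 ≤ C ∧ ∀ x ∈ Icc a b, |f x| ≤ C := by
  obtain ⟨C, hC⟩ := isCompact_Icc.exists_bound_of_continuousOn hf
  exact ⟨|C|, abs_nonneg _, fun x hx => (hC x hx).trans (le_abs_self _)⟩

theorem ContinuousOn.exists_osc_le_Icc {a b : ℝ} {f : ℝ → ℝ} (hf : ContinuousOn f (Icc a b))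
    {ε : ℝ} (hε : 0 < ε) :
    ∃ δ > 0, ∀ x ∈ Icc a b, ∀ y ∈ Icc a b, |y - x| < δ → |f y - f x| ≤ ε := by
  have := isCompact_Icc.uniformContinuousOn_of_continuous hf
  rw [Metric.uniformContinuousOn_iff] at this
  obtain ⟨δ, hδ, H⟩ := this ε hε
  refine ⟨δ, hδ, fun x hx y hy hxy => ?_⟩
  exact (H y hy x hx hxy).le

namespace HasLSDeriv

variable {a b : ℝ} {lm lp f g h f' g' h' : ℝ → ℝ}

theorem congr (H : HasLSDeriv a b lm lp f g h) (hf : EqOn f' f (Icc a b))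
    (hg : EqOn g' g (Icc a b)) (hh : EqOn h' h (Icc a b)) : HasLSDeriv a b lm lp f' g' h' := by
  obtain ⟨σ, hσ, H⟩ := H
  refine ⟨σ, hσ, fun ε hε => ?_⟩
  obtain ⟨δ, hδ, H⟩ := H ε hε
  refine ⟨δ, hδ, fun x hx y hy hxy hd => ?_⟩
  rw [hf hx, hf hy, hg hx, hh hx]
  exact H x hx y hy hxy hd

theorem demand : HasLSDeriv a b lm lp lm (fun _ => 1) (fun _ => 0) :=
  ⟨fun _ => 0, fun _ _ _ _ _ => le_rfl, fun _ _ => ⟨1, one_pos, by simp⟩⟩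

theorem supply : HasLSDeriv a b lm lp lp (fun _ => 0) (fun _ => 1) :=
  ⟨fun _ => 0, fun _ _ _ _ _ => le_rfl, fun _ _ => ⟨1, one_pos, by simp⟩⟩

theorem const_mul (H : HasLSDeriv a b lm lp f g h) (c : ℝ) :
    HasLSDeriv a b lm lp (fun x => c * f x) (fun x => c * g x) (fun x => c * h x) := by
  obtain ⟨σ, hσ, H⟩ := H
  refine ⟨fun x => |c| * σ x, fun x hx y hy hxy =>
    mul_le_mul_of_nonneg_left (hσ hx hy hxy) (abs_nonneg c), fun ε hε => ?_⟩
  obtain ⟨δ, hδ, H⟩ := H ε hε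
  refine ⟨δ, hδ, fun x hx y hy hxy hd => ?_⟩
  rw [show c * f y - c * f x - (c * g x * (lm y - lm x) + c * h x * (lp y - lp x)) =
    c * (f y - f x - (g x * (lm y - lm x) + h x * (lp y - lp x))) by ring, abs_mul]
  calc _ ≤ |c| * (ε * (σ y - σ x)) := by gcongr; exact H x hx y hy hxy hd
    _ = _ := by ring

theorem add (H : HasLSDeriv a b lm lp f g h) (H' : HasLSDeriv a b lm lp f' g' h') :
    HasLSDeriv a b lm lp (fun x => f x + f' x) (fun x => g x + g' x) (fun x => h x + h' x) := by
  obtain ⟨σ, hσ, H⟩ := H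
  obtain ⟨σ', hσ', H'⟩ := H'
  refine ⟨fun x => σ x + σ' x, hσ.add hσ', fun ε hε => ?_⟩
  obtain ⟨δ, hδ, H⟩ := H ε hε
  obtain ⟨δ', hδ', H'⟩ := H' ε hε
  refine ⟨min δ δ', lt_min hδ hδ', fun x hx y hy hxy hd => ?_⟩
  have h1 := abs_le.1 (H x hx y hy hxy (hd.trans_le (min_le_left _ _)))
  have h2 := abs_le.1 (H' x hx y hy hxy (hd.trans_le (min_le_right _ _)))
  exact abs_le.2 ⟨by linarith [h1.1, h2.1], by linarith [h1.2, h2.2]⟩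

theorem sub (H : HasLSDeriv a b lm lp f g h) (H' : HasLSDeriv a b lm lp f' g' h') :
    HasLSDeriv a b lm lp (fun x => f x - f' x) (fun x => g x - g' x) (fun x => h x - h' x) :=
  (H.add (H'.const_mul (-1))).congr (fun x _ => by ring) (fun x _ => by ring)
    (fun x _ => by ring)

theorem eq_of_deriv_eq_zero (H : HasLSDeriv a b lm lp f g h) (hg : ∀ x ∈ Icc a b, g x = 0)
    (hh : ∀ x ∈ Icc a b, h x = 0) {x y : ℝ} (hx : x ∈ Icc a b) (hy : y ∈ Icc a b) :
    f x = f y := by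
  wlog hxy : x ≤ y generalizing x y
  · exact (this hy hx (le_of_not_ge hxy)).symm
  obtain ⟨σ, hσ, H⟩ := H
  have key : ∀ ε > 0, |f y - f x| ≤ ε * (σ y - σ x) := by
    intro ε hε
    obtain ⟨δ, hδ, H⟩ := H ε hε
    have step : ∀ n : ℕ, ∀ u ∈ Icc a b, ∀ v ∈ Icc a b, u ≤ v → v - u < n * δ →
        |f v - f u| ≤ ε * (σ v - σ u) := by
      intro n
      induction n with
      | zero => intro u _ v _ huv h; simp at h; linarith
      | succ n ih =>
        intro u hu v hv huv hd
        rcases Nat.eq_zero_or_pos n with rfl | hn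
        · have := H u hu v hv huv (by simpa using hd)
          simpa [hg u hu, hh u hu] using this
        push_cast at hd
        have hn' : (0 : ℝ) < n := by exact_mod_cast hn
        have h1 : 0 ≤ (v - u) / (n + 1) := div_nonneg (by linarith) (by linarith)
        have h2 : (v - u) / (n + 1) < δ := by
          rw [div_lt_iff₀ (by linarith)]; linarith
        have h3 : (v - u) = (n + 1) * ((v - u) / (n + 1)) := by field_simp
        set d := (v - u) / (n + 1)
        have hm : v - d ∈ Icc a b := ⟨by nlinarith [hu.1], by linarith [hv.2]⟩
        have i1 := ih u hu (v - d) hm (by nlinarith) (by nlinarith)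
        have i2 := H (v - d) hm v hv (by linarith) (by linarith)
        simp only [hg _ hm, hh _ hm, zero_mul, add_zero, sub_zero] at i2
        calc |f v - f u| ≤ |f v - f (v - d)| + |f (v - d) - f u| := abs_sub_le _ _ _
          _ ≤ _ := by linarith
    obtain ⟨n, hn⟩ := exists_nat_gt ((y - x) / δ)
    exact step n x hx y hy hxy (by rwa [div_lt_iff₀ hδ] at hn)
  have hs : 0 ≤ σ y - σ x := by linarith [hσ hx hy hxy]
  have : |f y - f x| ≤ 0 := by
    refine le_of_forall_pos_le_add fun ε hε => ?_
    have := key (ε / (σ y - σ x + 1)) (by positivity)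
    refine this.trans ?_
    rw [div_mul_eq_mul_div, div_le_iff₀ (by positivity)]
    nlinarith
  have := abs_eq_zero.1 (le_antisymm this (abs_nonneg _))
  linarith

theorem mul (hlm : AntitoneOn lm (Icc a b)) (hlp : MonotoneOn lp (Icc a b))
    (H : HasLSDeriv a b lm lp f g h) (H' : HasLSDeriv a b lm lp f' g' h')
    (cf : ContinuousOn f (Icc a b)) (cg : ContinuousOn g (Icc a b)) (ch : ContinuousOn h (Icc a b))
    (cf' : ContinuousOn f' (Icc a b)) :
    HasLSDeriv a b lm lp (fun x => f x * f' x) (fun x => g x * f' x + f x * g' x)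
      (fun x => h x * f' x + f x * h' x) := by
  obtain ⟨σ, hσ, H⟩ := H
  obtain ⟨σ', hσ', H'⟩ := H'
  obtain ⟨F, F0, hF⟩ := cf.exists_abs_le_Icc
  obtain ⟨F', F0', hF'⟩ := cf'.exists_abs_le_Icc
  obtain ⟨G, G0, hG⟩ := cg.exists_abs_le_Icc
  obtain ⟨K, K0, hK⟩ := ch.exists_abs_le_Icc
  refine ⟨fun x => (G + K) * (lp x - lm x) + (F' * σ x + F * σ' x), ?_, fun ε hε => ?_⟩
  · intro x hx y hy hxy
    have h1 := hσ hx hy hxy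
    have h2 := hσ' hx hy hxy
    have h3 := hlm hx hy hxy
    have h4 := hlp hx hy hxy
    dsimp only
    gcongr
  obtain ⟨δ, hδ, H⟩ := H ε hε
  obtain ⟨δ', hδ', H'⟩ := H' ε hε
  obtain ⟨η, hη, O⟩ := cf'.exists_osc_le_Icc hε
  refine ⟨min (min δ δ') η, lt_min (lt_min hδ hδ') hη, fun x hx y hy hxy hd => ?_⟩
  have h1 := H x hx y hy hxy (hd.trans_le ((min_le_left _ _).trans (min_le_left _ _)))
  have h2 := H' x hx y hy hxy (hd.trans_le ((min_le_left _ _).trans (min_le_right _ _)))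
  have h3 := O x hx y hy (by rw [abs_of_nonneg (by linarith)]; exact hd.trans_le (min_le_right _ _))
  have m1 : 0 ≤ lm x - lm y := by linarith [hlm hx hy hxy]
  have m2 : 0 ≤ lp y - lp x := by linarith [hlp hx hy hxy]
  set D := g x * (lm y - lm x) + h x * (lp y - lp x) with hD
  set D' := g' x * (lm y - lm x) + h' x * (lp y - lp x) with hD'
  have hDb : |D| ≤ (G + K) * ((lp y - lp x) + (lm x - lm y)) := by
    refine (abs_add_le _ _).trans ?_
    rw [abs_mul, abs_mul, abs_of_nonneg m2, abs_sub_comm, abs_of_nonneg m1]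
    nlinarith [mul_le_mul_of_nonneg_right (hG x hx) m1, mul_le_mul_of_nonneg_right (hK x hx) m2,
      mul_nonneg G0 m2, mul_nonneg K0 m1]
  rw [show f y * f' y - f x * f' x - ((g x * f' x + f x * g' x) * (lm y - lm x) +
      (h x * f' x + f x * h' x) * (lp y - lp x)) =
      D * (f' y - f' x) + ((f y - f x - D) * f' y + f x * (f' y - f' x - D')) by
    rw [hD, hD']; ring]
  refine (abs_add_le _ _).trans ((add_le_add_right (abs_add_le _ _) _).trans ?_)
  rw [abs_mul, abs_mul, abs_mul]
  have e1 := mul_le_mul hDb h3 (abs_nonneg _) ((abs_nonneg _).trans hDb)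
  have e2 := mul_le_mul h1 (hF' y hy) (abs_nonneg _) ((abs_nonneg _).trans h1)
  have e3 := mul_le_mul (hF x hx) h2 (abs_nonneg _) F0
  linarith

theorem inv (hlm : AntitoneOn lm (Icc a b)) (hlp : MonotoneOn lp (Icc a b))
    (H : HasLSDeriv a b lm lp f g h) (cf : ContinuousOn f (Icc a b))
    (hf : ∀ x ∈ Icc a b, f x ≠ 0)
    (cg : ContinuousOn g (Icc a b)) (ch : ContinuousOn h (Icc a b)) :
    HasLSDeriv a b lm lp (fun x => (f x)⁻¹) (fun x => -(g x * (f x)⁻¹ ^ 2))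
      (fun x => -(h x * (f x)⁻¹ ^ 2)) := by
  have ci : ContinuousOn (fun x => (f x)⁻¹) (Icc a b) := cf.inv₀ hf
  obtain ⟨σ, hσ, H⟩ := H
  obtain ⟨F, F0, hF⟩ := ci.exists_abs_le_Icc
  obtain ⟨G, G0, hG⟩ := cg.exists_abs_le_Icc
  obtain ⟨K, K0, hK⟩ := ch.exists_abs_le_Icc
  refine ⟨fun x => F * ((G + K) * (lp x - lm x)) + F ^ 2 * σ x, ?_, fun ε hε => ?_⟩
  · intro x hx y hy hxy
    have h1 := hσ hx hy hxy
    have h3 := hlm hx hy hxy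
    have h4 := hlp hx hy hxy
    dsimp only
    gcongr
  obtain ⟨δ, hδ, H⟩ := H ε hε
  obtain ⟨η, hη, O⟩ := ci.exists_osc_le_Icc hε
  refine ⟨min δ η, lt_min hδ hη, fun x hx y hy hxy hd => ?_⟩
  have h1 := H x hx y hy hxy (hd.trans_le (min_le_left _ _))
  have h3 := O x hx y hy (by rw [abs_of_nonneg (by linarith)]; exact hd.trans_le (min_le_right _ _))
  have m1 : 0 ≤ lm x - lm y := by linarith [hlm hx hy hxy]
  have m2 : 0 ≤ lp y - lp x := by linarith [hlp hx hy hxy]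
  set D := g x * (lm y - lm x) + h x * (lp y - lp x) with hD
  have hDb : |D| ≤ (G + K) * ((lp y - lp x) + (lm x - lm y)) := by
    refine (abs_add_le _ _).trans ?_
    rw [abs_mul, abs_mul, abs_of_nonneg m2, abs_sub_comm, abs_of_nonneg m1]
    nlinarith [mul_le_mul_of_nonneg_right (hG x hx) m1, mul_le_mul_of_nonneg_right (hK x hx) m2,
      mul_nonneg G0 m2, mul_nonneg K0 m1]
  have fx := hf x hx
  have fy := hf y hy
  rw [show (f y)⁻¹ - (f x)⁻¹ - (-(g x * (f x)⁻¹ ^ 2) * (lm y - lm x) +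
      -(h x * (f x)⁻¹ ^ 2) * (lp y - lp x)) =
      -((f x)⁻¹ * D * ((f y)⁻¹ - (f x)⁻¹)) + -((f x)⁻¹ * (f y)⁻¹ * (f y - f x - D)) by
    rw [hD]; field_simp; ring]
  refine (abs_add_le _ _).trans ?_
  rw [abs_neg, abs_neg, abs_mul, abs_mul, abs_mul, abs_mul]
  have e1 := mul_le_mul (mul_le_mul (hF x hx) hDb (abs_nonneg _) F0) h3 (abs_nonneg _)
    (mul_nonneg F0 ((abs_nonneg _).trans hDb))
  have e2 := mul_le_mul (mul_le_mul (hF x hx) (hF y hy) (abs_nonneg _) F0) h1 (abs_nonneg _)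
    (mul_nonneg F0 F0)
  linarith

end HasLSDeriv

/-- Continuous positive demand and supply functions on `[a,b]`, together with finite measures
whose distribution functions they are, up to an atom of `μm` at `b` and one of `μp` at `a`. -/
structure IsMarket (a b : ℝ) (lm lp : ℝ → ℝ) (μm μp : Measure ℝ) : Prop where
  lt : a < b
  cont_demand : ContinuousOn lm (Icc a b)
  cont_supply : ContinuousOn lp (Icc a b)
  anti : AntitoneOn lm (Icc a b)
  mono : MonotoneOn lp (Icc a b)
  demand_pos : ∀ x ∈ Icc a b, 0 < lm x
  supply_pos : ∀ x ∈ Icc a b, 0 < lp x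
  finite_demand : IsFiniteMeasure μm
  finite_supply : IsFiniteMeasure μp
  demand_Ico : ∀ x ∈ Icc a b, ∀ y ∈ Icc a b, x ≤ y → μm.real (Ico x y) = lm x - lm y
  supply_Ioc : ∀ x ∈ Icc a b, ∀ y ∈ Icc a b, x ≤ y → μp.real (Ioc x y) = lp y - lp x

theorem abs_setIntegral_sub_const_le {ρ : Measure ℝ} {s : Set ℝ}
    (hρ : ρ s ≠ ∞) {h : ℝ → ℝ} (hh : IntegrableOn h s ρ) {c ε : ℝ}
    (H : ∀ t ∈ s, |h t - c| ≤ ε) : |(∫ t in s, h t ∂ρ) - c * ρ.real s| ≤ ε * ρ.real s := by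
  have h1 : ∫ t in s, (h t - c) ∂ρ = (∫ t in s, h t ∂ρ) - c * ρ.real s := by
    rw [integral_sub hh (integrableOn_const hρ), setIntegral_const, smul_eq_mul, mul_comm]
  rw [← h1]
  exact norm_setIntegral_le_of_norm_le_const hρ.lt_top fun t ht =>
    (Real.norm_eq_abs _).trans_le (H t ht)

namespace IsMarket

variable {a b : ℝ} {lm lp : ℝ → ℝ} {μm μp : Measure ℝ}

theorem hasLSDeriv_of_integral_supply (M : IsMarket a b lm lp μm μp) {f h : ℝ → ℝ}
    (ch : ContinuousOn h (Icc a b))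
    (H : ∀ x ∈ Icc a b, ∀ y ∈ Icc a b, x ≤ y → f y - f x = ∫ t in Ioc x y, h t ∂μp) :
    HasLSDeriv a b lm lp f (fun _ => 0) h := by
  have := M.finite_supply
  refine ⟨lp, M.mono, fun ε hε => ?_⟩
  obtain ⟨δ, hδ, O⟩ := ch.exists_osc_le_Icc hε
  refine ⟨δ, hδ, fun x hx y hy hxy hd => ?_⟩
  rw [H x hx y hy hxy, ← M.supply_Ioc x hx y hy hxy, zero_mul, zero_add]
  have hsub : Ioc x y ⊆ Icc a b := fun t ht => ⟨hx.1.trans ht.1.le, ht.2.trans hy.2⟩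
  refine abs_setIntegral_sub_const_le (measure_ne_top _ _)
    (ch.integrableOn_Icc.mono_set hsub) fun t ht => O x hx t (hsub ht) ?_
  rw [abs_of_nonneg (by linarith [ht.1])]
  linarith [ht.2]

theorem hasLSDeriv_of_integral_demand (M : IsMarket a b lm lp μm μp) {f g : ℝ → ℝ}
    (cg : ContinuousOn g (Icc a b))
    (H : ∀ x ∈ Icc a b, ∀ y ∈ Icc a b, x ≤ y → f x - f y = ∫ t in Ico x y, g t ∂μm) :
    HasLSDeriv a b lm lp f g (fun _ => 0) := by
  have := M.finite_demand
  refine ⟨fun x => -lm x, M.anti.neg, fun ε hε => ?_⟩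
  obtain ⟨δ, hδ, O⟩ := cg.exists_osc_le_Icc hε
  refine ⟨δ, hδ, fun x hx y hy hxy hd => ?_⟩
  have h1 := M.demand_Ico x hx y hy hxy
  have hsub : Ico x y ⊆ Icc a b := fun t ht => ⟨hx.1.trans ht.1, ht.2.le.trans hy.2⟩
  have h2 : |(∫ t in Ico x y, g t ∂μm) - g x * μm.real (Ico x y)| ≤ ε * μm.real (Ico x y) := by
    refine abs_setIntegral_sub_const_le (measure_ne_top _ _)
      (cg.integrableOn_Icc.mono_set hsub) fun t ht => O x hx t (hsub ht) ?_
    rw [abs_of_nonneg (by linarith [ht.1])]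
    linarith [ht.2]
  rw [← H x hx y hy hxy, h1] at h2
  rw [← abs_neg]
  convert h2 using 1
  · congr 1; ring
  · ring

theorem setIntegral_Ioc_sub (ρ : Measure ℝ) {h : ℝ → ℝ} (hh : IntegrableOn h (Icc a b) ρ)
    {x y : ℝ} (hx : x ∈ Icc a b) (hy : y ∈ Icc a b) (hxy : x ≤ y) :
    (∫ t in Ioc a y, h t ∂ρ) - ∫ t in Ioc a x, h t ∂ρ = ∫ t in Ioc x y, h t ∂ρ := by
  rw [← Ioc_union_Ioc_eq_Ioc hx.1 hxy, setIntegral_union _ measurableSet_Ioc]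
  · ring
  · exact hh.mono_set fun t ht => ⟨ht.1.le, ht.2.trans hx.2⟩
  · exact hh.mono_set fun t ht => ⟨hx.1.trans ht.1.le, ht.2.trans hy.2⟩
  · exact Ioc_disjoint_Ioc_of_le le_rfl

theorem setIntegral_Ico_add (ρ : Measure ℝ) {h : ℝ → ℝ} (hh : IntegrableOn h (Icc a b) ρ)
    {x y w : ℝ} (hx : x ∈ Icc a b) (hw : w ∈ Icc a b) (hxy : x ≤ y) (hyw : y ≤ w) :
    (∫ t in Ico x y, h t ∂ρ) + ∫ t in Ico y w, h t ∂ρ = ∫ t in Ico x w, h t ∂ρ := by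
  rw [← Ico_union_Ico_eq_Ico hxy hyw, setIntegral_union _ measurableSet_Ico]
  · exact hh.mono_set fun t ht => ⟨hx.1.trans ht.1, (ht.2.le.trans hyw).trans hw.2⟩
  · exact hh.mono_set fun t ht => ⟨hx.1.trans (hxy.trans ht.1), ht.2.le.trans hw.2⟩
  · exact Ico_disjoint_Ico_same

theorem setIntegral_Ioc_add (ρ : Measure ℝ) {h : ℝ → ℝ} (hh : IntegrableOn h (Icc a b) ρ)
    {x y w : ℝ} (hx : x ∈ Icc a b) (hw : w ∈ Icc a b) (hxy : x ≤ y) (hyw : y ≤ w) :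
    (∫ t in Ioc x y, h t ∂ρ) + ∫ t in Ioc y w, h t ∂ρ = ∫ t in Ioc x w, h t ∂ρ := by
  rw [← Ioc_union_Ioc_eq_Ioc hxy hyw, setIntegral_union _ measurableSet_Ioc]
  · exact hh.mono_set fun t ht => ⟨hx.1.trans ht.1.le, (ht.2.trans hyw).trans hw.2⟩
  · exact hh.mono_set fun t ht => ⟨hx.1.trans (hxy.trans ht.1.le), ht.2.trans hw.2⟩
  · exact Ioc_disjoint_Ioc_of_le le_rfl

theorem integral_supply_eq_sub (M : IsMarket a b lm lp μm μp) {f h : ℝ → ℝ}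
    (ch : ContinuousOn h (Icc a b)) (H : HasLSDeriv a b lm lp f (fun _ => 0) h)
    {x y : ℝ} (hx : x ∈ Icc a b) (hy : y ∈ Icc a b) (hxy : x ≤ y) :
    ∫ t in Ioc x y, h t ∂μp = f y - f x := by
  have := M.finite_supply
  have K : ∀ x ∈ Icc a b, ∀ y ∈ Icc a b, x ≤ y →
      (∫ t in Ioc a y, h t ∂μp) - (∫ t in Ioc a x, h t ∂μp) = ∫ t in Ioc x y, h t ∂μp :=
    fun x hx y hy hxy => setIntegral_Ioc_sub μp ch.integrableOn_Icc hx hy hxy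
  have := (H.sub (M.hasLSDeriv_of_integral_supply ch K)).eq_of_deriv_eq_zero
    (fun _ _ => sub_self _) (fun _ _ => sub_self _) hx hy
  rw [← K x hx y hy hxy]
  linarith

theorem integral_demand_eq_sub (M : IsMarket a b lm lp μm μp) {f g : ℝ → ℝ}
    (cg : ContinuousOn g (Icc a b)) (H : HasLSDeriv a b lm lp f g (fun _ => 0))
    {x y : ℝ} (hx : x ∈ Icc a b) (hy : y ∈ Icc a b) (hxy : x ≤ y) :
    ∫ t in Ico x y, g t ∂μm = f x - f y := by
  have := M.finite_demand
  have K : ∀ x ∈ Icc a b, ∀ y ∈ Icc a b, x ≤ y →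
      (∫ t in Ico x b, g t ∂μm) - (∫ t in Ico y b, g t ∂μm) = ∫ t in Ico x y, g t ∂μm := by
    intro x hx y hy hxy
    rw [← setIntegral_Ico_add μm cg.integrableOn_Icc hx ⟨M.lt.le, le_rfl⟩ hxy hy.2]
    ring
  have := (H.sub (M.hasLSDeriv_of_integral_demand cg K)).eq_of_deriv_eq_zero
    (fun _ _ => sub_self _) (fun _ _ => sub_self _) hx hy
  rw [← K x hx y hy hxy]
  linarith

/-- The demand measure has no atoms in `[a,b)`. -/
theorem demand_singleton (M : IsMarket a b lm lp μm μp) {z : ℝ} (hz : z ∈ Ico a b) :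
    μm {z} = 0 := by
  have := M.finite_demand
  have hz' : z ∈ Icc a b := ⟨hz.1, hz.2.le⟩
  have h1 : Tendsto (fun y => lm z - lm y) (𝓝[Ioc z b] z) (𝓝 (lm z - lm z)) :=
    tendsto_const_nhds.sub ((M.cont_demand z hz').mono fun t ht => ⟨hz.1.trans ht.1.le, ht.2⟩)
  have hne : (𝓝[Ioc z b] z).NeBot := by
    rw [nhdsWithin_Ioc_eq_nhdsGT hz.2]; infer_instance
  have h2 : μm.real {z} ≤ lm z - lm z := by
    refine ge_of_tendsto h1 (eventually_mem_nhdsWithin.mono fun y hy => ?_)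
    rw [← M.demand_Ico z hz' y ⟨hz.1.trans hy.1.le, hy.2⟩ hy.1.le]
    exact measureReal_mono (singleton_subset_iff.2 ⟨le_rfl, hy.1⟩)
  have h3 : μm.real {z} = 0 := le_antisymm (by linarith) measureReal_nonneg
  simpa [measureReal_eq_zero_iff] using h3

end IsMarket

/-! ### Lebesgue-Stieltjes signed measures -/

theorem rLim_eq {a b : ℝ} {f : ℝ → ℝ} (cf : ContinuousOn f (Icc a b)) {x : ℝ}
    (hx : x ∈ Icc a b) : rLim b f x = f x := by
  unfold rLim
  split_ifs with h
  · refine ContinuousWithinAt.rightLim_eq ((cf x hx).mono_of_mem_nhdsWithin ?_)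
    exact mem_of_superset (Icc_mem_nhdsGE h) (Icc_subset_Icc_left hx.1)
  · rw [le_antisymm hx.2 (not_lt.1 h)]

theorem exists_isLS {a b : ℝ} (hab : a < b) {f : ℝ → ℝ} (cf : ContinuousOn f (Icc a b))
    (hf : BoundedVariationOn f (Icc a b)) : ∃ ν, IsLS a b f ν := by
  set F : ℝ → ℝ := fun x => f (max a (min b x)) with hF
  have hclamp : ∀ x, max a (min b x) ∈ Icc a b := fun x =>
    ⟨le_max_left _ _, max_le hab.le (min_le_left _ _)⟩
  have cF : Continuous F := cf.comp_continuous (by fun_prop) hclamp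
  have bF : BoundedVariationOn F univ := by
    refine ne_top_of_le_ne_top hf (eVariationOn.comp_le_of_monotoneOn f _ ?_ fun x _ => hclamp x)
    intro x _ y _ hxy
    dsimp only
    gcongr
  have hFf : ∀ x ∈ Icc a b, F x = f x := fun x hx => by
    simp [hF, max_eq_right hx.1, min_eq_right hx.2]
  have hr : ∀ x, Function.rightLim F x = F x := fun x =>
    (cF.continuousAt.continuousWithinAt).rightLim_eq
  have hl : ∀ x, Function.leftLim F x = F x := fun x =>
    (cF.continuousAt.continuousWithinAt).leftLim_eq
  refine ⟨bF.vectorMeasure.restrict (Icc a b), fun s hs h => ?_, fun x y hax hxy hyb => ?_, ?_⟩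
  · rw [VectorMeasure.restrict_apply _ measurableSet_Icc hs, h, VectorMeasure.empty]
  · have hx : x ∈ Icc a b := ⟨hax, hxy.trans hyb⟩
    have hy : y ∈ Icc a b := ⟨hax.trans hxy, hyb⟩
    rw [VectorMeasure.restrict_apply _ measurableSet_Icc measurableSet_Ioc,
      inter_eq_left.2 (Ioc_subset_Icc_self.trans (Icc_subset_Icc hax hyb)),
      bF.vectorMeasure_Ioc hxy, hr, hr, hFf x hx, hFf y hy, rLim_eq cf hx, rLim_eq cf hy]
  · have ha : a ∈ Icc a b := ⟨le_rfl, hab.le⟩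
    rw [VectorMeasure.restrict_apply _ measurableSet_Icc (measurableSet_singleton a),
      inter_eq_left.2 (singleton_subset_iff.2 ha), bF.vectorMeasure_singleton, hr, hl, rLim_eq cf ha]
    simp

theorem IsLS.apply_Ioc {a b : ℝ} {f : ℝ → ℝ} (cf : ContinuousOn f (Icc a b))
    {ν : SignedMeasure ℝ} (H : IsLS a b f ν) {x y : ℝ} (hx : x ∈ Icc a b) (hy : y ∈ Icc a b)
    (hxy : x ≤ y) : ν (Ioc x y) = f y - f x := by
  rw [H.2.1 x y hx.1 hxy hy.2, rLim_eq cf hx, rLim_eq cf hy]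

theorem IsLS.exists_abs_sInt_sub_le {a b : ℝ} {f g : ℝ → ℝ} (cf : ContinuousOn f (Icc a b))
    (cg : ContinuousOn g (Icc a b)) {ν : SignedMeasure ℝ} (H : IsLS a b f ν) :
    ∃ σ : ℝ → ℝ, MonotoneOn σ (Icc a b) ∧ ∀ ε > 0, ∃ δ > 0, ∀ x ∈ Icc a b, ∀ y ∈ Icc a b,
      x ≤ y → y - x < δ → |sInt ν g (Ioc x y) - g x * (f y - f x)| ≤ ε * (σ y - σ x) := by
  set P := ν.toJordanDecomposition.posPart
  set N := ν.toJordanDecomposition.negPart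
  have hP : ∀ x ∈ Icc a b, ∀ y ∈ Icc a b, x ≤ y → ∀ ρ : Measure ℝ, IsFiniteMeasure ρ →
      ρ.real (Ioc x y) = ρ.real (Ioc a y) - ρ.real (Ioc a x) := by
    intro x hx y hy hxy ρ _
    rw [← Ioc_union_Ioc_eq_Ioc hx.1 hxy,
      measureReal_union (Ioc_disjoint_Ioc_of_le le_rfl) measurableSet_Ioc]
    ring
  refine ⟨fun x => P.real (Ioc a x) + N.real (Ioc a x), fun x _ y _ hxy => ?_, fun ε hε => ?_⟩
  · exact add_le_add (measureReal_mono (Ioc_subset_Ioc_right hxy))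
      (measureReal_mono (Ioc_subset_Ioc_right hxy))
  obtain ⟨δ, hδ, O⟩ := cg.exists_osc_le_Icc hε
  refine ⟨δ, hδ, fun x hx y hy hxy hd => ?_⟩
  have hsub : Ioc x y ⊆ Icc a b := fun t ht => ⟨hx.1.trans ht.1.le, ht.2.trans hy.2⟩
  have key : ∀ ρ : Measure ℝ, IsFiniteMeasure ρ →
      |(∫ t in Ioc x y, g t ∂ρ) - g x * ρ.real (Ioc x y)| ≤ ε * ρ.real (Ioc x y) := by
    intro ρ _
    refine abs_setIntegral_sub_const_le (measure_ne_top _ _)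
      (cg.integrableOn_Icc.mono_set hsub) fun t ht => O x hx t (hsub ht) ?_
    rw [abs_of_nonneg (by linarith [ht.1])]
    linarith [ht.2]
  have k1 := abs_le.1 (key P inferInstance)
  have k2 := abs_le.1 (key N inferInstance)
  have k3 : f y - f x = P.real (Ioc x y) - N.real (Ioc x y) := by
    rw [← H.apply_Ioc cf hx hy hxy]
    exact ν.apply_eq_posPart_real_sub_negPart_real measurableSet_Ioc
  rw [k3]
  have h1 := hP x hx y hy hxy P inferInstance
  have h2 := hP x hx y hy hxy N inferInstance
  unfold sInt
  refine abs_le.2 ⟨?_, ?_⟩ <;> dsimp only <;> nlinarith [k1.1, k1.2, k2.1, k2.2]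

/-- If `p dF + k df = 0`, then `df = -(p/k) dF`. -/
theorem exists_abs_sub_div_mul_le {a b : ℝ} {F f p k : ℝ → ℝ} (cF : ContinuousOn F (Icc a b))
    (cf : ContinuousOn f (Icc a b)) (cp : ContinuousOn p (Icc a b)) (ck : ContinuousOn k (Icc a b))
    (hk : ∀ x ∈ Icc a b, k x ≠ 0) {νF νf : SignedMeasure ℝ} (HF : IsLS a b F νF)
    (Hf : IsLS a b f νf) (H : ∀ s, MeasurableSet s → sInt νF p s + sInt νf k s = 0) :
    ∃ σ : ℝ → ℝ, MonotoneOn σ (Icc a b) ∧ ∀ ε > 0, ∃ δ > 0, ∀ x ∈ Icc a b, ∀ y ∈ Icc a b,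
      x ≤ y → y - x < δ → |f y - f x - -(p x * (k x)⁻¹) * (F y - F x)| ≤ ε * (σ y - σ x) := by
  obtain ⟨σ, hσ, A⟩ := HF.exists_abs_sInt_sub_le cF cp
  obtain ⟨τ, hτ, B⟩ := Hf.exists_abs_sInt_sub_le cf ck
  obtain ⟨C, C0, hC⟩ := (ck.inv₀ hk).exists_abs_le_Icc
  refine ⟨fun x => C * (σ x + τ x), fun x hx y hy hxy => ?_, fun ε hε => ?_⟩
  · exact mul_le_mul_of_nonneg_left (add_le_add (hσ hx hy hxy) (hτ hx hy hxy)) C0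
  obtain ⟨δ, hδ, A⟩ := A ε hε
  obtain ⟨η, hη, B⟩ := B ε hε
  refine ⟨min δ η, lt_min hδ hη, fun x hx y hy hxy hd => ?_⟩
  have h1 := abs_le.1 (A x hx y hy hxy (hd.trans_le (min_le_left _ _)))
  have h2 := abs_le.1 (B x hx y hy hxy (hd.trans_le (min_le_right _ _)))
  have h3 := H (Ioc x y) measurableSet_Ioc
  have h4 : |p x * (F y - F x) + k x * (f y - f x)| ≤ ε * ((σ y + τ y) - (σ x + τ x)) :=
    abs_le.2 ⟨by linarith, by linarith⟩
  have kx := hk x hx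
  rw [show f y - f x - -(p x * (k x)⁻¹) * (F y - F x) =
    (k x)⁻¹ * (p x * (F y - F x) + k x * (f y - f x)) by field_simp; ring, abs_mul]
  have := mul_le_mul (hC x hx) h4 (abs_nonneg _) C0
  rw [Pi.inv_apply] at this
  dsimp only
  linarith

/-- The integral of `1 / (lp lm²)` over `[x,b)` against the demand measure. -/
def demandPotential (b : ℝ) (lm lp : ℝ → ℝ) (μm : Measure ℝ) (x : ℝ) : ℝ :=
  ∫ t in Ico x b, (lp t)⁻¹ * (lm t)⁻¹ ^ 2 ∂μm

theorem continuousOn_of_abs_sub_le {s : Set ℝ} {f k : ℝ → ℝ} {C : ℝ} (hk : ContinuousOn k s)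
    (H : ∀ x ∈ s, ∀ y ∈ s, x ≤ y → |f y - f x| ≤ C * |k y - k x|) : ContinuousOn f s := by
  have H' : ∀ x ∈ s, ∀ y ∈ s, |f y - f x| ≤ C * |k y - k x| := by
    intro x hx y hy
    rcases le_total x y with h | h
    · exact H x hx y hy h
    · rw [abs_sub_comm, abs_sub_comm (k y)]
      exact H y hy x hx h
  intro x hx
  have h0 : Tendsto (fun y => C * |k y - k x|) (𝓝[s] x) (𝓝 0) := by
    have h : Tendsto (fun y => C * |k y - k x|) (𝓝[s] x) (𝓝 (C * |k x - k x|)) :=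
      (((hk x hx).sub tendsto_const_nhds).abs).const_mul C
    simpa using h
  have h1 : Tendsto (fun y => |f y - f x|) (𝓝[s] x) (𝓝 0) :=
    squeeze_zero' (Eventually.of_forall fun _ => abs_nonneg _)
      (eventually_mem_nhdsWithin.mono fun y hy => H' x hx y hy) h0
  exact tendsto_iff_norm_sub_tendsto_zero.2 h1

namespace IsMarket

variable {a b : ℝ} {lm lp : ℝ → ℝ} {μm μp : Measure ℝ}

theorem left_mem (M : IsMarket a b lm lp μm μp) : a ∈ Icc a b := ⟨le_rfl, M.lt.le⟩

theorem right_mem (M : IsMarket a b lm lp μm μp) : b ∈ Icc a b := ⟨M.lt.le, le_rfl⟩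

theorem cont_inv_demand (M : IsMarket a b lm lp μm μp) :
    ContinuousOn (fun t => (lm t)⁻¹) (Icc a b) :=
  M.cont_demand.inv₀ fun x hx => (M.demand_pos x hx).ne'

theorem cont_inv_supply (M : IsMarket a b lm lp μm μp) :
    ContinuousOn (fun t => (lp t)⁻¹) (Icc a b) :=
  M.cont_supply.inv₀ fun x hx => (M.supply_pos x hx).ne'

theorem hasLSDeriv_inv_demand (M : IsMarket a b lm lp μm μp) :
    HasLSDeriv a b lm lp (fun t => (lm t)⁻¹) (fun t => -(lm t)⁻¹ ^ 2) (fun _ => 0) :=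
  (HasLSDeriv.demand.inv M.anti M.mono M.cont_demand (fun x hx => (M.demand_pos x hx).ne')
    continuousOn_const continuousOn_const).congr (fun _ _ => rfl) (fun _ _ => by ring)
    (fun _ _ => by ring)

theorem hasLSDeriv_inv_supply (M : IsMarket a b lm lp μm μp) :
    HasLSDeriv a b lm lp (fun t => (lp t)⁻¹) (fun _ => 0) (fun t => -(lp t)⁻¹ ^ 2) :=
  (HasLSDeriv.supply.inv M.anti M.mono M.cont_supply (fun x hx => (M.supply_pos x hx).ne')
    continuousOn_const continuousOn_const).congr (fun _ _ => rfl) (fun _ _ => by ring)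
    (fun _ _ => by ring)

theorem continuousOn_of_integral_demand (M : IsMarket a b lm lp μm μp) {f g : ℝ → ℝ} {C : ℝ}
    (hC : ∀ x ∈ Icc a b, |g x| ≤ C)
    (H : ∀ x ∈ Icc a b, ∀ y ∈ Icc a b, x ≤ y → f x - f y = ∫ t in Ico x y, g t ∂μm) :
    ContinuousOn f (Icc a b) := by
  have := M.finite_demand
  refine continuousOn_of_abs_sub_le (C := C) M.cont_demand fun x hx y hy hxy => ?_
  rw [abs_sub_comm, H x hx y hy hxy, abs_sub_comm, ← M.demand_Ico x hx y hy hxy,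
    abs_of_nonneg measureReal_nonneg]
  exact norm_setIntegral_le_of_norm_le_const (measure_lt_top _ _) fun t (ht : t ∈ Ico x y) =>
    (Real.norm_eq_abs _).trans_le (hC t ⟨hx.1.trans ht.1, ht.2.le.trans hy.2⟩)

theorem continuousOn_of_integral_supply (M : IsMarket a b lm lp μm μp) {f g : ℝ → ℝ} {C : ℝ}
    (hC : ∀ x ∈ Icc a b, |g x| ≤ C)
    (H : ∀ x ∈ Icc a b, ∀ y ∈ Icc a b, x ≤ y → f y - f x = ∫ t in Ioc x y, g t ∂μp) :
    ContinuousOn f (Icc a b) := by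
  have := M.finite_supply
  refine continuousOn_of_abs_sub_le (C := C) M.cont_supply fun x hx y hy hxy => ?_
  rw [H x hx y hy hxy, ← M.supply_Ioc x hx y hy hxy, abs_of_nonneg measureReal_nonneg]
  exact norm_setIntegral_le_of_norm_le_const (measure_lt_top _ _) fun t (ht : t ∈ Ioc x y) =>
    (Real.norm_eq_abs _).trans_le (hC t ⟨hx.1.trans ht.1.le, ht.2.trans hy.2⟩)

theorem cont_demandPotential_integrand (M : IsMarket a b lm lp μm μp) :
    ContinuousOn (fun t => (lp t)⁻¹ * (lm t)⁻¹ ^ 2) (Icc a b) :=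
  M.cont_inv_supply.mul (M.cont_inv_demand.pow 2)

theorem demandPotential_sub (M : IsMarket a b lm lp μm μp) {x y : ℝ} (hx : x ∈ Icc a b)
    (hy : y ∈ Icc a b) (hxy : x ≤ y) :
    demandPotential b lm lp μm x - demandPotential b lm lp μm y =
      ∫ t in Ico x y, (lp t)⁻¹ * (lm t)⁻¹ ^ 2 ∂μm := by
  have := M.finite_demand
  unfold demandPotential
  rw [← setIntegral_Ico_add μm M.cont_demandPotential_integrand.integrableOn_Icc hx M.right_mem
    hxy hy.2]
  ring

theorem demandPotential_right : demandPotential b lm lp μm b = 0 := by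
  simp [demandPotential]

theorem demandPotential_anti (M : IsMarket a b lm lp μm μp) :
    AntitoneOn (demandPotential b lm lp μm) (Icc a b) := by
  intro x hx y hy hxy
  have h1 : 0 ≤ ∫ t in Ico x y, (lp t)⁻¹ * (lm t)⁻¹ ^ 2 ∂μm :=
    setIntegral_nonneg measurableSet_Ico fun t ht => by
      have ht' : t ∈ Icc a b := ⟨hx.1.trans ht.1, ht.2.le.trans hy.2⟩
      have := M.demand_pos t ht'
      have := M.supply_pos t ht'
      positivity
  rw [← M.demandPotential_sub hx hy hxy] at h1
  linarith

theorem demandPotential_nonneg (M : IsMarket a b lm lp μm μp) {x : ℝ} (hx : x ∈ Icc a b) :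
    0 ≤ demandPotential b lm lp μm x := by
  have := M.demandPotential_anti hx M.right_mem hx.2
  rwa [demandPotential_right] at this

theorem cont_demandPotential (M : IsMarket a b lm lp μm μp) :
    ContinuousOn (demandPotential b lm lp μm) (Icc a b) := by
  obtain ⟨C, -, hC⟩ := M.cont_demandPotential_integrand.exists_abs_le_Icc
  exact M.continuousOn_of_integral_demand hC fun _ hx _ hy hxy => M.demandPotential_sub hx hy hxy

theorem hasLSDeriv_demandPotential (M : IsMarket a b lm lp μm μp) :
    HasLSDeriv a b lm lp (demandPotential b lm lp μm) (fun t => (lp t)⁻¹ * (lm t)⁻¹ ^ 2)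
      (fun _ => 0) :=
  M.hasLSDeriv_of_integral_demand M.cont_demandPotential_integrand
    fun _ hx _ hy hxy => M.demandPotential_sub hx hy hxy

theorem integral_demandPotential (M : IsMarket a b lm lp μm μp) {x y : ℝ} (hx : x ∈ Icc a b)
    (hy : y ∈ Icc a b) (hxy : x ≤ y) :
    ∫ t in Ioc x y, demandPotential b lm lp μm t ∂μp =
      ((lm y)⁻¹ + demandPotential b lm lp μm y * lp y) -
        ((lm x)⁻¹ + demandPotential b lm lp μm x * lp x) := by
  refine M.integral_supply_eq_sub
    (f := fun t => (lm t)⁻¹ + demandPotential b lm lp μm t * lp t) M.cont_demandPotential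
    ?_ hx hy hxy
  refine (M.hasLSDeriv_inv_demand.add (M.hasLSDeriv_demandPotential.mul M.anti M.mono
    HasLSDeriv.supply M.cont_demandPotential M.cont_demandPotential_integrand continuousOn_const
    M.cont_supply)).congr (fun _ _ => rfl) (fun t ht => ?_) (fun t ht => ?_)
  · have := (M.demand_pos t ht).ne'
    have := (M.supply_pos t ht).ne'
    field_simp
    ring
  · ring

theorem integral_inv_mul_inv_add_demandPotential (M : IsMarket a b lm lp μm μp) {x y : ℝ}
    (hx : x ∈ Icc a b) (hy : y ∈ Icc a b) (hxy : x ≤ y) :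
    ∫ t in Ico x y, ((lp t)⁻¹ * (lm t)⁻¹ + demandPotential b lm lp μm t) ∂μm =
      demandPotential b lm lp μm x * lm x - demandPotential b lm lp μm y * lm y := by
  refine M.integral_demand_eq_sub
    (f := fun t => demandPotential b lm lp μm t * lm t)
    ((M.cont_inv_supply.mul M.cont_inv_demand).add M.cont_demandPotential) ?_ hx hy hxy
  refine (M.hasLSDeriv_demandPotential.mul M.anti M.mono
    HasLSDeriv.demand M.cont_demandPotential M.cont_demandPotential_integrand continuousOn_const
    M.cont_demand).congr (fun _ _ => rfl) (fun t ht => ?_) (fun t ht => ?_)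
  · have := (M.demand_pos t ht).ne'
    have := (M.supply_pos t ht).ne'
    simp only [Pi.add_apply, Pi.mul_apply]
    field_simp
  · ring

theorem eq_zero_of_homogeneous (M : IsMarket a b lm lp μm μp) {u v : ℝ → ℝ}
    (iu : IntegrableOn u (Icc a b) μm) (iv : IntegrableOn v (Icc a b) μp)
    (bu : ∃ C, ∀ x ∈ Icc a b, |u x| ≤ C) (bv : ∃ C, ∀ x ∈ Icc a b, |v x| ≤ C)
    (cu : ContinuousWithinAt u (Iio b) b) (cv : ContinuousWithinAt v (Ioi a) a)
    (ua : u a = 0) (vb : v b = 0)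
    (H : ∀ x ∈ Ico a b, ∀ y ∈ Ioc a b, x < y →
      ((∫ t in Ico a y, u t ∂μm) - v y * lm y) + ((∫ t in Ioc x b, v t ∂μp) - u x * lp x) = 0) :
    ∀ x ∈ Icc a b, u x = 0 ∧ v x = 0 := by
  have hab := M.lt
  obtain ⟨C, hC⟩ := bu
  obtain ⟨D, hD⟩ := bv
  set A : ℝ → ℝ := fun y => ∫ t in Ico a y, u t ∂μm with hA
  set B : ℝ → ℝ := fun x => ∫ t in Ioc x b, v t ∂μp with hB
  have dA : ∀ x ∈ Icc a b, ∀ y ∈ Icc a b, x ≤ y → A y - A x = ∫ t in Ico x y, u t ∂μm := by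
    intro x hx y hy hxy
    simp only [hA]
    rw [← setIntegral_Ico_add μm iu M.left_mem hy hx.1 hxy]
    ring
  have dB : ∀ x ∈ Icc a b, ∀ y ∈ Icc a b, x ≤ y → B x - B y = ∫ t in Ioc x y, v t ∂μp := by
    intro x hx y hy hxy
    simp only [hB]
    rw [← setIntegral_Ioc_add μp iv hx M.right_mem hxy hy.2]
    ring
  have cA : ContinuousOn A (Icc a b) := by
    have := M.continuousOn_of_integral_demand (f := fun x => -A x) hC
      fun x hx y hy hxy => by rw [← dA x hx y hy hxy]; ring
    exact this.neg.congr fun x _ => (neg_neg _).symm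
  have cB : ContinuousOn B (Icc a b) := by
    have := M.continuousOn_of_integral_supply (f := fun x => -B x) hD
      fun x hx y hy hxy => by rw [← dB x hx y hy hxy]; ring
    exact this.neg.congr fun x _ => (neg_neg _).symm
  have Aa : A a = 0 := by simp [hA]
  have Bb : B b = 0 := by simp [hB]
  set κ := A b with hκ
  have hBa : B a = -κ := by
    have := H a ⟨le_rfl, hab⟩ b ⟨hab, le_rfl⟩ hab
    rw [ua, vb] at this
    simp only [hκ]
    linarith
  have nA : (𝓝[Ioc a b] a).NeBot := by rw [nhdsWithin_Ioc_eq_nhdsGT hab]; infer_instance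
  have nB : (𝓝[Ico a b] b).NeBot := by rw [nhdsWithin_Ico_eq_nhdsLT hab]; infer_instance
  have hv : ∀ y ∈ Icc a b, v y * lm y = A y - κ := by
    have h1 : ∀ y ∈ Ioc a b, v y * lm y = A y - κ := by
      intro y hy
      have := H a ⟨le_rfl, hab⟩ y hy hy.1
      rw [ua] at this
      linarith
    intro y hy
    rcases eq_or_lt_of_le hy.1 with rfl | h
    · have t1 : Tendsto (fun y => v y * lm y) (𝓝[Ioc a b] a) (𝓝 (v a * lm a)) :=
        (cv.mono Ioc_subset_Ioi_self).mul ((M.cont_demand a hy).mono Ioc_subset_Icc_self)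
      have t2 : Tendsto (fun y => A y - κ) (𝓝[Ioc a b] a) (𝓝 (A a - κ)) :=
        ((cA a hy).mono Ioc_subset_Icc_self).sub tendsto_const_nhds
      exact tendsto_nhds_unique (t1.congr' (eventually_mem_nhdsWithin.mono h1)) t2
    · exact h1 y ⟨h, hy.2⟩
  have hu : ∀ x ∈ Icc a b, u x * lp x = B x + κ := by
    have h1 : ∀ y ∈ Ico a b, u y * lp y = B y + κ := by
      intro y hy
      have := H y hy b ⟨hab, le_rfl⟩ hy.2
      rw [vb] at this
      linarith
    intro y hy
    rcases eq_or_lt_of_le hy.2 with rfl | h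
    · have t1 : Tendsto (fun x => u x * lp x) (𝓝[Ico a y] y) (𝓝 (u y * lp y)) :=
        (cu.mono Ico_subset_Iio_self).mul ((M.cont_supply y hy).mono Ico_subset_Icc_self)
      have t2 : Tendsto (fun x => B x + κ) (𝓝[Ico a y] y) (𝓝 (B y + κ)) :=
        ((cB y hy).mono Ico_subset_Icc_self).add tendsto_const_nhds
      exact tendsto_nhds_unique (t1.congr' (eventually_mem_nhdsWithin.mono h1)) t2
    · exact h1 y ⟨hy.1, h⟩
  have hv' : ∀ y ∈ Icc a b, v y = (A y - κ) * (lm y)⁻¹ := fun y hy => by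
    rw [← hv y hy]; have := (M.demand_pos y hy).ne'; field_simp
  have hu' : ∀ y ∈ Icc a b, u y = (B y + κ) * (lp y)⁻¹ := fun y hy => by
    rw [← hu y hy]; have := (M.supply_pos y hy).ne'; field_simp
  have cv' : ContinuousOn v (Icc a b) :=
    ((cA.sub continuousOn_const).mul M.cont_inv_demand).congr hv'
  have cu' : ContinuousOn u (Icc a b) :=
    ((cB.add continuousOn_const).mul M.cont_inv_supply).congr hu'
  have DA : HasLSDeriv a b lm lp (fun x => A x - κ) (fun x => -u x) (fun _ => 0) := by
    refine M.hasLSDeriv_of_integral_demand cu'.neg fun x hx y hy hxy => ?_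
    rw [integral_neg, ← dA x hx y hy hxy]
    ring
  have DB : HasLSDeriv a b lm lp (fun x => B x + κ) (fun _ => 0) (fun x => -v x) := by
    refine M.hasLSDeriv_of_integral_supply cv'.neg fun x hx y hy hxy => ?_
    rw [integral_neg, ← dB x hx y hy hxy]
    ring
  have D1 := (DA.mul M.anti M.mono HasLSDeriv.supply (cA.sub continuousOn_const) cu'.neg
    continuousOn_const M.cont_supply).add (DB.mul M.anti M.mono HasLSDeriv.demand
    (cB.add continuousOn_const) continuousOn_const cv'.neg M.cont_demand)
  have T : ∀ x ∈ Icc a b, (u x + v x) * (lm x * lp x) = v a * (lm a * lp a) := by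
    intro x hx
    have := D1.eq_of_deriv_eq_zero (fun x hx => by simp only [← hu x hx]; ring)
      (fun x hx => by simp only [← hv x hx]; ring) hx M.left_mem
    simp only [← hu x hx, ← hv x hx, ← hu a M.left_mem, ← hv a M.left_mem, ua] at this
    linarith
  have D2 := (DA.mul M.anti M.mono M.hasLSDeriv_inv_demand (cA.sub continuousOn_const) cu'.neg
    continuousOn_const M.cont_inv_demand).add
    (M.hasLSDeriv_demandPotential.const_mul (v a * (lm a * lp a)))
  have V : ∀ x ∈ Icc a b, v x = -(v a * (lm a * lp a)) * demandPotential b lm lp μm x := by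
    intro x hx
    have := D2.eq_of_deriv_eq_zero (fun x hx => by
        simp only [← hv x hx]
        have h1 := M.demand_pos x hx
        have h2 := M.supply_pos x hx
        rw [← T x hx]
        field_simp
        ring) (fun x hx => by simp) hx M.right_mem
    rw [← hv' x hx, ← hv' b M.right_mem, vb, demandPotential_right] at this
    linarith
  have va : v a = 0 := by
    have h1 := V a M.left_mem
    have h2 : v a * (1 + (lm a * lp a) * demandPotential b lm lp μm a) = 0 := by linarith
    have := mul_pos (M.demand_pos a M.left_mem) (M.supply_pos a M.left_mem)
    have := mul_nonneg this.le (M.demandPotential_nonneg M.left_mem)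
    exact (mul_eq_zero.1 h2).resolve_right (by positivity)
  intro x hx
  have v0 : v x = 0 := by rw [V x hx, va]; ring
  have := T x hx
  rw [v0, va, zero_mul, add_zero] at this
  exact ⟨(mul_eq_zero.1 this).resolve_right
    (mul_pos (M.demand_pos x hx) (M.supply_pos x hx)).ne', v0⟩

end IsMarket

theorem BoundedVariationOn.fun_add {f g : ℝ → ℝ} {s : Set ℝ} (hf : BoundedVariationOn f s)
    (hg : BoundedVariationOn g s) : BoundedVariationOn (fun x => f x + g x) s := by
  refine ne_top_of_le_ne_top (ENNReal.add_ne_top.2 ⟨hf, hg⟩) (iSup_le fun p => ?_)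
  calc ∑ i ∈ Finset.range p.1, edist (f (p.2.1 (i + 1)) + g (p.2.1 (i + 1)))
        (f (p.2.1 i) + g (p.2.1 i))
      ≤ ∑ i ∈ Finset.range p.1, (edist (f (p.2.1 (i + 1))) (f (p.2.1 i)) +
        edist (g (p.2.1 (i + 1))) (g (p.2.1 i))) :=
        Finset.sum_le_sum fun i _ => edist_add_add_le _ _ _ _
    _ ≤ eVariationOn f s + eVariationOn g s := by
        rw [Finset.sum_add_distrib]
        exact add_le_add (eVariationOn.sum_le p.2.2.1 p.2.2.2)
          (eVariationOn.sum_le p.2.2.1 p.2.2.2)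

theorem MonotoneOn.boundedVariationOn_Icc {f : ℝ → ℝ} {a b : ℝ} (hf : MonotoneOn f (Icc a b)) :
    BoundedVariationOn f (Icc a b) := by
  refine hf.boundedVariationOn (C := max |f a| |f b|) fun x hx => ?_
  have h : a ≤ b := hx.1.trans hx.2
  exact abs_le_max_abs_abs (hf ⟨le_rfl, h⟩ hx hx.1) (hf hx ⟨h, le_rfl⟩ hx.2)

theorem BoundedVariationOn.fun_const_mul {f : ℝ → ℝ} {a b : ℝ} (c : ℝ)
    (hf : BoundedVariationOn f (Icc a b)) : BoundedVariationOn (fun x => c * f x) (Icc a b) :=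
  BoundedVariationOn.mul (f := fun _ => c) monotoneOn_const.boundedVariationOn_Icc hf

theorem AntitoneOn.boundedVariationOn_Icc {f : ℝ → ℝ} {a b : ℝ} (hf : AntitoneOn f (Icc a b)) :
    BoundedVariationOn f (Icc a b) := by
  simpa using hf.neg.boundedVariationOn_Icc.fun_const_mul (-1)

theorem BoundedVariationOn.fun_sub {f g : ℝ → ℝ} {a b : ℝ} (hf : BoundedVariationOn f (Icc a b))
    (hg : BoundedVariationOn g (Icc a b)) : BoundedVariationOn (fun x => f x - g x) (Icc a b) := by
  simpa [sub_eq_add_neg] using hf.fun_add (hg.fun_const_mul (-1))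

theorem BoundedVariationOn.exists_abs_le {f : ℝ → ℝ} {a b : ℝ}
    (hf : BoundedVariationOn f (Icc a b)) : ∃ C, ∀ x ∈ Icc a b, |f x| ≤ C := by
  refine ⟨|f a| + (eVariationOn f (Icc a b)).toReal, fun x hx => ?_⟩
  have := hf.dist_le hx ⟨le_rfl, hx.1.trans hx.2⟩
  rw [Real.dist_eq] at this
  have h := abs_sub_abs_le_abs_sub (f x) (f a)
  linarith

theorem BoundedVariationOn.integrableOn_Icc {f : ℝ → ℝ} {a b : ℝ}
    (hf : BoundedVariationOn f (Icc a b)) (ρ : Measure ℝ) [IsFiniteMeasure ρ] :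
    IntegrableOn f (Icc a b) ρ := by
  obtain ⟨p, q, hp, hq, h⟩ := hf.locallyBoundedVariationOn.exists_monotoneOn_sub_monotoneOn
  rw [h]
  exact (hp.integrableOn_isCompact isCompact_Icc).sub (hq.integrableOn_isCompact isCompact_Icc)

theorem ContinuousOn.continuousWithinAt_Iio {f : ℝ → ℝ} {a b : ℝ} (hf : ContinuousOn f (Icc a b))
    {x : ℝ} (hx : x ∈ Ioc a b) : ContinuousWithinAt f (Iio x) x :=
  (hf x ⟨hx.1.le, hx.2⟩).mono_of_mem_nhdsWithin
    (mem_of_superset (Ico_mem_nhdsLT hx.1) fun _ ht => ⟨ht.1, ht.2.le.trans hx.2⟩)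

theorem ContinuousOn.continuousWithinAt_Ioi {f : ℝ → ℝ} {a b : ℝ} (hf : ContinuousOn f (Icc a b))
    {x : ℝ} (hx : x ∈ Ico a b) : ContinuousWithinAt f (Ioi x) x :=
  (hf x ⟨hx.1, hx.2.le⟩).mono_of_mem_nhdsWithin
    (mem_of_superset (Ioc_mem_nhdsGT hx.2) fun _ ht => ⟨hx.1.trans ht.1.le, ht.2⟩)

theorem continuousWithinAt_Iio_ite_lt (z x : ℝ) :
    ContinuousWithinAt (fun t => if z < t then (1 : ℝ) else 0) (Iio x) x := by
  rcases le_or_gt x z with h | h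
  · exact (continuousWithinAt_const (b := (0 : ℝ))).congr
      (fun t ht => if_neg ((le_of_lt ht).trans h).not_gt) (if_neg h.not_gt)
  · refine (continuousWithinAt_const (b := (1 : ℝ))).congr_of_eventuallyEq ?_ (if_pos h)
    filter_upwards [Ioo_mem_nhdsLT h] with t ht using if_pos ht.1

/-- The value of the generator at a configuration with best buy offer `x` and best sell offer
`y`, for the linear functional with weight functions `wm, wp`. -/
def bestOfferGen (a b : ℝ) (lm lp : ℝ → ℝ) (μm μp : Measure ℝ) (wm wp : ℝ → ℝ) (x y : ℝ) : ℝ :=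
  ((∫ t in Ico a y, wm t ∂μm) - wp y * lm y) + ((∫ t in Ioc x b, wp t ∂μp) - wm x * lp x)

namespace IsMarket

variable {a b : ℝ} {lm lp : ℝ → ℝ} {μm μp : Measure ℝ}

theorem boundedVariationOn_inv_mul_inv (M : IsMarket a b lm lp μm μp) :
    BoundedVariationOn (fun t => (lp t)⁻¹ * (lm t)⁻¹) (Icc a b) := by
  refine BoundedVariationOn.mul (AntitoneOn.boundedVariationOn_Icc fun x hx y hy hxy => ?_)
    (MonotoneOn.boundedVariationOn_Icc fun x hx y hy hxy => ?_)
  · exact inv_anti₀ (M.supply_pos x hx) (M.mono hx hy hxy)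
  · exact inv_anti₀ (M.demand_pos y hy) (M.anti hx hy hxy)

theorem max_mem {z : ℝ} (hz : z ∈ Icc a b) {x : ℝ} (hx : x ∈ Icc a b) : max x z ∈ Icc a b :=
  ⟨hx.1.trans (le_max_left _ _), max_le hx.2 hz.2⟩

theorem cont_demandPotential_max (M : IsMarket a b lm lp μm μp) {z : ℝ} (hz : z ∈ Icc a b) :
    ContinuousOn (fun t => demandPotential b lm lp μm (max t z)) (Icc a b) :=
  M.cont_demandPotential.comp (by fun_prop) fun _ hx => max_mem hz hx

theorem boundedVariationOn_demandPotential_max (M : IsMarket a b lm lp μm μp) {z : ℝ}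
    (hz : z ∈ Icc a b) :
    BoundedVariationOn (fun t => demandPotential b lm lp μm (max t z)) (Icc a b) :=
  AntitoneOn.boundedVariationOn_Icc fun _ hx _ hy hxy =>
    M.demandPotential_anti (max_mem hz hx) (max_mem hz hy) (max_le_max_right z hxy)

theorem boundedVariationOn_jump (M : IsMarket a b lm lp μm μp) {z : ℝ} (hz : z ∈ Icc a b) :
    BoundedVariationOn (fun t => (if z < t then 1 else 0) * ((lp t)⁻¹ * (lm t)⁻¹) +
      demandPotential b lm lp μm (max t z)) (Icc a b) := by
  refine BoundedVariationOn.fun_add (BoundedVariationOn.mul (MonotoneOn.boundedVariationOn_Icc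
    fun x _ y _ hxy => ?_) M.boundedVariationOn_inv_mul_inv)
    (M.boundedVariationOn_demandPotential_max hz)
  split_ifs with h1 h2 <;> first | exact absurd (h1.trans_le hxy) h2 | norm_num

theorem integral_demandPotential_max (M : IsMarket a b lm lp μm μp) {z : ℝ} (hz : z ∈ Icc a b)
    {x : ℝ} (hx : x ∈ Icc a b) :
    ∫ t in Ioc x b, demandPotential b lm lp μm (max t z) ∂μp =
      (lm b)⁻¹ - ((lm (max x z))⁻¹ + demandPotential b lm lp μm (max x z) * lp (max x z)) +
        demandPotential b lm lp μm z * (lp (max x z) - lp x) := by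
  have := M.finite_supply
  have hm := max_mem hz hx
  rw [← setIntegral_Ioc_add μp (M.cont_demandPotential_max hz).integrableOn_Icc hx M.right_mem
    (le_max_left x z) hm.2]
  have h1 : ∫ t in Ioc x (max x z), demandPotential b lm lp μm (max t z) ∂μp =
      demandPotential b lm lp μm z * (lp (max x z) - lp x) := by
    rw [setIntegral_congr_fun (g := fun _ => demandPotential b lm lp μm z) measurableSet_Ioc
      fun t ht => ?_, setIntegral_const, smul_eq_mul, M.supply_Ioc x hx _ hm (le_max_left x z),
      mul_comm]
    have : t ≤ z := (le_max_iff.1 ht.2).resolve_left ht.1.not_ge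
    simp only [max_eq_right this]
  have h2 : ∫ t in Ioc (max x z) b, demandPotential b lm lp μm (max t z) ∂μp =
      ∫ t in Ioc (max x z) b, demandPotential b lm lp μm t ∂μp :=
    setIntegral_congr_fun measurableSet_Ioc fun t ht => by
      simp only [max_eq_left ((le_max_right x z).trans ht.1.le)]
  rw [h1, h2, M.integral_demandPotential hm M.right_mem hm.2, demandPotential_right]
  ring

theorem integral_jump (M : IsMarket a b lm lp μm μp) {z : ℝ} (hz : z ∈ Icc a b)
    {y : ℝ} (hy : y ∈ Icc a b) :
    ∫ t in Ico a y, ((if z < t then 1 else 0) * ((lp t)⁻¹ * (lm t)⁻¹) +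
        demandPotential b lm lp μm (max t z)) ∂μm =
      demandPotential b lm lp μm z * lm a - demandPotential b lm lp μm (max y z) * lm y := by
  have := M.finite_demand
  have key : ∀ w ∈ Icc a b, w ≤ z → ∫ t in Ico a w,
      ((if z < t then 1 else 0) * ((lp t)⁻¹ * (lm t)⁻¹) +
        demandPotential b lm lp μm (max t z)) ∂μm =
      demandPotential b lm lp μm z * (lm a - lm w) := by
    intro w hw hwz
    rw [setIntegral_congr_fun (g := fun _ => demandPotential b lm lp μm z) measurableSet_Ico
      fun t ht => ?_, setIntegral_const, smul_eq_mul, M.demand_Ico a M.left_mem w hw hw.1,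
      mul_comm]
    have : t ≤ z := ht.2.le.trans hwz
    simp only [max_eq_right this, this.not_gt, if_false, zero_mul, zero_add]
  rcases le_total y z with h | h
  · rw [key y hy h, max_eq_right h]
    ring
  · rw [← setIntegral_Ico_add μm ((M.boundedVariationOn_jump hz).integrableOn_Icc μm) M.left_mem
      hy hz.1 h, key z hz le_rfl, max_eq_left h]
    have h2 : ∫ t in Ico z y, ((if z < t then 1 else 0) * ((lp t)⁻¹ * (lm t)⁻¹) +
        demandPotential b lm lp μm (max t z)) ∂μm =
        ∫ t in Ico z y, ((lp t)⁻¹ * (lm t)⁻¹ + demandPotential b lm lp μm t) ∂μm := by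
      rcases eq_or_lt_of_le h with rfl | h'
      · simp
      have h0 : ∀ᵐ t ∂μm, t ≠ z := by
        rw [ae_iff]
        simpa using M.demand_singleton ⟨hz.1, h'.trans_le hy.2⟩
      refine setIntegral_congr_ae measurableSet_Ico (h0.mono fun t ht hm => ?_)
      have : z < t := lt_of_le_of_ne hm.1 (Ne.symm ht)
      simp only [this, if_true, one_mul, max_eq_left hm.1]
    rw [h2, M.integral_inv_mul_inv_add_demandPotential hz hy h]
    ring

end IsMarket

namespace IsMarket

variable {a b : ℝ} {lm lp : ℝ → ℝ} {μm μp : Measure ℝ}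

theorem eqOn_of_bestOfferGen_eq (M : IsMarket a b lm lp μm μp) {wm wp wm' wp' : ℝ → ℝ}
    (hw : WPair a b wm wp) (hw' : WPair a b wm' wp')
    (H : ∀ x ∈ Ico a b, ∀ y ∈ Ioc a b, x < y →
      bestOfferGen a b lm lp μm μp wm' wp' x y = bestOfferGen a b lm lp μm μp wm wp x y) :
    EqOn wm' wm (Icc a b) ∧ EqOn wp' wp (Icc a b) := by
  have := M.finite_demand
  have := M.finite_supply
  obtain ⟨-, -, vm, vp, cm, cp, am, bp⟩ := hw
  obtain ⟨-, -, vm', vp', cm', cp', am', bp'⟩ := hw'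
  have key := M.eq_zero_of_homogeneous (u := fun t => wm' t - wm t) (v := fun t => wp' t - wp t)
    ((vm'.fun_sub vm).integrableOn_Icc μm) ((vp'.fun_sub vp).integrableOn_Icc μp)
    (vm'.fun_sub vm).exists_abs_le (vp'.fun_sub vp).exists_abs_le
    ((cm' b ⟨M.lt, le_rfl⟩).sub (cm b ⟨M.lt, le_rfl⟩))
    ((cp' a ⟨le_rfl, M.lt⟩).sub (cp a ⟨le_rfl, M.lt⟩)) (by rw [am, am', sub_self])
    (by rw [bp, bp', sub_self]) fun x hx y hy hxy => ?_
  · exact ⟨fun x hx => sub_eq_zero.1 (key x hx).1, fun x hx => sub_eq_zero.1 (key x hx).2⟩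
  · have h := H x hx y hy hxy
    have hm : Ico a y ⊆ Icc a b := fun t ht => ⟨ht.1, ht.2.le.trans hy.2⟩
    have hp : Ioc x b ⊆ Icc a b := fun t ht => ⟨hx.1.trans ht.1.le, ht.2⟩
    rw [integral_sub ((vm'.integrableOn_Icc μm).mono_set hm) ((vm.integrableOn_Icc μm).mono_set hm),
      integral_sub ((vp'.integrableOn_Icc μp).mono_set hp) ((vp.integrableOn_Icc μp).mono_set hp)]
    unfold bestOfferGen at h
    linarith

theorem exists_bestOfferGen_eq (M : IsMarket a b lm lp μm μp) {z θ K : ℝ} (hz : z ∈ Icc a b)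
    (hθ : θ = lm z * ((lm b)⁻¹ - K * demandPotential b lm lp μm z))
    (hK : K * (1 + lp a * lm a * demandPotential b lm lp μm a) = lm a + lp a * lm a * (lm b)⁻¹) :
    ∃ wm wp, WPair a b wm wp ∧ ∀ x ∈ Ico a b, ∀ y ∈ Ioc a b, x < y →
      bestOfferGen a b lm lp μm μp wm wp x y = (if x ≤ z then 1 else 0) - θ := by
  have := M.finite_demand
  have := M.finite_supply
  set U := demandPotential b lm lp μm with hU
  have pa := M.supply_pos a M.left_mem
  have ma := M.demand_pos a M.left_mem
  have mb := M.demand_pos b M.right_mem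
  have Ua : 0 ≤ U a := M.demandPotential_nonneg M.left_mem
  have Ub : U b = 0 := demandPotential_right
  have sa : (lp a)⁻¹ * (lm a)⁻¹ + U a ≠ 0 := by positivity
  obtain ⟨c, hc⟩ : ∃ c, c * ((lp a)⁻¹ * (lm a)⁻¹ + U a) + lm z * U z = 0 :=
    ⟨-(lm z * U z) / ((lp a)⁻¹ * (lm a)⁻¹ + U a), by rw [div_mul_cancel₀ _ sa]; ring⟩
  have vU : BoundedVariationOn U (Icc a b) := M.demandPotential_anti.boundedVariationOn_Icc
  have vs := M.boundedVariationOn_inv_mul_inv.fun_add vU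
  have vJ := M.boundedVariationOn_jump hz
  have vM := M.boundedVariationOn_demandPotential_max hz
  have vm := (vs.fun_const_mul c).fun_add (vJ.fun_const_mul (lm z))
  have vp := (vU.fun_const_mul (-c)).fun_add (vM.fun_const_mul (-lm z))
  have cs := (M.cont_inv_supply.mul M.cont_inv_demand)
  refine ⟨_, _, ⟨vm.exists_abs_le, vp.exists_abs_le, vm, vp, fun x hx => ?_, fun x hx => ?_, ?_, ?_⟩,
    fun x hx y hy hxy => ?_⟩
  · have c1 := cs.continuousWithinAt_Iio hx
    have c2 := M.cont_demandPotential.continuousWithinAt_Iio hx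
    have c3 := (M.cont_demandPotential_max hz).continuousWithinAt_Iio hx
    exact ((c1.add c2).const_mul c).add
      ((((continuousWithinAt_Iio_ite_lt z x).mul c1).add c3).const_mul (lm z))
  · have c2 := M.cont_demandPotential.continuousWithinAt_Ioi hx
    have c3 := (M.cont_demandPotential_max hz).continuousWithinAt_Ioi hx
    exact (c2.const_mul (-c)).add (c3.const_mul (-lm z))
  · simpa [hz.1.not_gt, max_eq_right hz.1] using hc
  · simp [max_eq_left hz.2, Ub, demandPotential_right]
  · have hx' : x ∈ Icc a b := ⟨hx.1, hx.2.le⟩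
    have hy' : y ∈ Icc a b := ⟨hy.1.le, hy.2⟩
    have hm : Ico a y ⊆ Icc a b := fun t ht => ⟨ht.1, ht.2.le.trans hy.2⟩
    have hp : Ioc x b ⊆ Icc a b := fun t ht => ⟨hx.1.trans ht.1.le, ht.2⟩
    unfold bestOfferGen
    rw [integral_add (((vs.fun_const_mul c).integrableOn_Icc μm).mono_set hm)
        (((vJ.fun_const_mul (lm z)).integrableOn_Icc μm).mono_set hm),
      integral_add (((vU.fun_const_mul (-c)).integrableOn_Icc μp).mono_set hp)
        (((vM.fun_const_mul (-lm z)).integrableOn_Icc μp).mono_set hp),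
      integral_const_mul, integral_const_mul, integral_const_mul, integral_const_mul,
      M.integral_inv_mul_inv_add_demandPotential M.left_mem hy' hy'.1, M.integral_jump hz hy',
      M.integral_demandPotential hx' M.right_mem hx'.2, M.integral_demandPotential_max hz hx',
      ← hU, Ub]
    have mx := M.demand_pos x hx'
    have px := M.supply_pos x hx'
    have mz := M.demand_pos z hz
    have hid : (c + lm z) * (lm b)⁻¹ = θ + (c * (U a * lm a) + lm z * U z * lm a) := by
      have h1 : lm z * U z = -c * ((lp a)⁻¹ * (lm a)⁻¹ + U a) := by linarith
      have h2 : K * ((lp a)⁻¹ * (lm a)⁻¹ + U a) = (lp a)⁻¹ + (lm b)⁻¹ := by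
        field_simp at hK ⊢
        linarith
      have h3 : θ = lm z * (lm b)⁻¹ + c * ((lp a)⁻¹ + (lm b)⁻¹) := by
        rw [hθ, ← h2]
        linear_combination (-K) * h1
      rw [h3, h1]
      field_simp
      ring
    have e : (lp x)⁻¹ * (lm x)⁻¹ * lp x = (lm x)⁻¹ := by field_simp
    rcases le_or_gt x z with h | h
    · have ez : lm z * (lm z)⁻¹ = 1 := by field_simp
      simp only [max_eq_right h, h, h.not_gt, if_true, if_false]
      linear_combination (-1 : ℝ) * hid - c * e + ez
    · simp only [max_eq_left h.le, h, h.not_ge, if_true, if_false]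
      linear_combination (-1 : ℝ) * hid - (c + lm z) * e

end IsMarket

/-- The integral of `1 / (lm lp²)` over `(a,x]` against the supply measure. -/
def supplyPotential (a : ℝ) (lm lp : ℝ → ℝ) (μp : Measure ℝ) (x : ℝ) : ℝ :=
  ∫ t in Ioc a x, (lm t)⁻¹ * (lp t)⁻¹ ^ 2 ∂μp

namespace IsMarket

variable {a b : ℝ} {lm lp : ℝ → ℝ} {μm μp : Measure ℝ}

theorem hasLSDeriv_supplyPotential (M : IsMarket a b lm lp μm μp) :
    HasLSDeriv a b lm lp (supplyPotential a lm lp μp) (fun _ => 0)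
      (fun t => (lm t)⁻¹ * (lp t)⁻¹ ^ 2) := by
  have := M.finite_supply
  have c : ContinuousOn (fun t => (lm t)⁻¹ * (lp t)⁻¹ ^ 2) (Icc a b) :=
    M.cont_inv_demand.mul (M.cont_inv_supply.pow 2)
  exact M.hasLSDeriv_of_integral_supply c fun x hx y hy hxy =>
    setIntegral_Ioc_sub μp c.integrableOn_Icc hx hy hxy

theorem exists_luckockSol_eq (M : IsMarket a b lm lp μm μp) {fm fp : ℝ → ℝ}
    (hsol : LuckockSol a b lm lp fm fp) :
    ∃ K, K * (1 + lp a * lm a * demandPotential b lm lp μm a) = lm a + lp a * lm a * (lm b)⁻¹ ∧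
      K * (1 + lm b * lp b * supplyPotential a lm lp μp b) = lp b + lm b * lp b * (lp a)⁻¹ ∧
      ∀ z ∈ Icc a b, fm z = lm z * ((lm b)⁻¹ - K * demandPotential b lm lp μm z) ∧
        fp z = lp z * ((lp a)⁻¹ - K * supplyPotential a lm lp μp z) := by
  obtain ⟨cfm, cfp, vfm, vfp, fmb, fpa, H⟩ := hsol
  obtain ⟨νm, hνm⟩ := exists_isLS M.lt M.cont_demand M.anti.boundedVariationOn_Icc
  obtain ⟨νp, hνp⟩ := exists_isLS M.lt M.cont_supply M.mono.boundedVariationOn_Icc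
  obtain ⟨ρm, hρm⟩ := exists_isLS M.lt cfm vfm
  obtain ⟨ρp, hρp⟩ := exists_isLS M.lt cfp vfp
  have H := H νm νp ρm ρp hνm hνp hρm hρp
  have hm0 : ∀ x ∈ Icc a b, lm x ≠ 0 := fun x hx => (M.demand_pos x hx).ne'
  have hp0 : ∀ x ∈ Icc a b, lp x ≠ 0 := fun x hx => (M.supply_pos x hx).ne'
  have Dp : HasLSDeriv a b lm lp fp (fun _ => 0) (fun t => -(fm t * (lm t)⁻¹)) := by
    obtain ⟨σ, hσ, h⟩ := exists_abs_sub_div_mul_le M.cont_supply cfp cfm M.cont_demand hm0 hνp hρp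
      fun s hs => (H s hs).1
    refine ⟨σ, hσ, fun ε hε => ?_⟩
    obtain ⟨δ, hδ, h⟩ := h ε hε
    exact ⟨δ, hδ, fun x hx y hy hxy hd => by simpa using h x hx y hy hxy hd⟩
  have Dm : HasLSDeriv a b lm lp fm (fun t => -(fp t * (lp t)⁻¹)) (fun _ => 0) := by
    obtain ⟨σ, hσ, h⟩ := exists_abs_sub_div_mul_le M.cont_demand cfm cfp M.cont_supply hp0 hνm hρm
      fun s hs => (H s hs).2
    refine ⟨σ, hσ, fun ε hε => ?_⟩
    obtain ⟨δ, hδ, h⟩ := h ε hε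
    exact ⟨δ, hδ, fun x hx y hy hxy hd => by simpa using h x hx y hy hxy hd⟩
  have cgm : ContinuousOn (fun t => -(fp t * (lp t)⁻¹)) (Icc a b) :=
    (cfp.mul M.cont_inv_supply).neg
  have cgp : ContinuousOn (fun t => -(fm t * (lm t)⁻¹)) (Icc a b) :=
    (cfm.mul M.cont_inv_demand).neg
  have hK : ∀ x ∈ Icc a b, fm x * lp x + fp x * lm x = fm a * lp a + lm a := by
    intro x hx
    have := ((Dm.mul M.anti M.mono HasLSDeriv.supply cfm cgm continuousOn_const M.cont_supply).add
      (Dp.mul M.anti M.mono HasLSDeriv.demand cfp continuousOn_const cgp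
        M.cont_demand)).eq_of_deriv_eq_zero
      (fun x hx => by have := hp0 x hx; field_simp; ring)
      (fun x hx => by have := hm0 x hx; field_simp; ring) hx M.left_mem
    rwa [fpa, one_mul] at this
  set K := fm a * lp a + lm a with hKdef
  have hfm : ∀ z ∈ Icc a b, fm z = lm z * ((lm b)⁻¹ - K * demandPotential b lm lp μm z) := by
    intro z hz
    have := ((Dm.mul M.anti M.mono M.hasLSDeriv_inv_demand cfm cgm continuousOn_const
      M.cont_inv_demand).add (M.hasLSDeriv_demandPotential.const_mul K)).eq_of_deriv_eq_zero
      (fun x hx => by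
        have := hp0 x hx
        have := hm0 x hx
        rw [← hK x hx]
        field_simp
        ring) (fun x hx => by simp) hz M.right_mem
    rw [fmb, demandPotential_right] at this
    have := hm0 z hz
    field_simp at *
    linarith
  have hfp : ∀ z ∈ Icc a b, fp z = lp z * ((lp a)⁻¹ - K * supplyPotential a lm lp μp z) := by
    intro z hz
    have := ((Dp.mul M.anti M.mono M.hasLSDeriv_inv_supply cfp continuousOn_const cgp
      M.cont_inv_supply).add (M.hasLSDeriv_supplyPotential.const_mul K)).eq_of_deriv_eq_zero
      (fun x hx => by simp) (fun x hx => by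
        have := hp0 x hx
        have := hm0 x hx
        rw [← hK x hx]
        field_simp
        ring) hz M.left_mem
    have h0 : supplyPotential a lm lp μp a = 0 := by simp [supplyPotential]
    rw [fpa, h0] at this
    have := hp0 z hz
    field_simp at *
    linarith
  refine ⟨K, ?_, ?_, fun z hz => ⟨hfm z hz, hfp z hz⟩⟩
  · have := hfm a M.left_mem
    have h : K = fm a * lp a + lm a := rfl
    linear_combination h + lp a * this
  · have := hfp b M.right_mem
    have h := hK b M.right_mem
    rw [fmb] at h
    linear_combination -h + lm b * this

end IsMarket

theorem setIntegral_Ico_map_neg (ρ : Measure ℝ) (f : ℝ → ℝ) (x y : ℝ) :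
    ∫ t in Ico x y, f (-t) ∂ρ.map Neg.neg = ∫ t in Ioc (-y) (-x), f t ∂ρ := by
  rw [measurableEmbedding_neg.setIntegral_map]
  simp

theorem setIntegral_Ioc_map_neg (ρ : Measure ℝ) (f : ℝ → ℝ) (x y : ℝ) :
    ∫ t in Ioc x y, f (-t) ∂ρ.map Neg.neg = ∫ t in Ico (-y) (-x), f t ∂ρ := by
  rw [measurableEmbedding_neg.setIntegral_map]
  simp

theorem neg_mem_Icc_of_mem {a b x : ℝ} (hx : x ∈ Icc (-b) (-a)) : -x ∈ Icc a b :=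
  ⟨le_neg_of_le_neg hx.2, neg_le_of_neg_le hx.1⟩

theorem bestOfferGen_comp_neg (a b : ℝ) (lm lp : ℝ → ℝ) (μm μp : Measure ℝ) (wm wp : ℝ → ℝ)
    (x y : ℝ) :
    bestOfferGen (-b) (-a) (fun t => lp (-t)) (fun t => lm (-t)) (μp.map Neg.neg)
      (μm.map Neg.neg) (fun t => wp (-t)) (fun t => wm (-t)) x y =
      bestOfferGen a b lm lp μm μp wm wp (-y) (-x) := by
  unfold bestOfferGen
  rw [setIntegral_Ico_map_neg, setIntegral_Ioc_map_neg, neg_neg, neg_neg]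
  ring

theorem WPair.comp_neg {a b : ℝ} {wm wp : ℝ → ℝ} (h : WPair a b wm wp) :
    WPair (-b) (-a) (fun t => wp (-t)) (fun t => wm (-t)) := by
  obtain ⟨⟨C, hC⟩, ⟨D, hD⟩, vm, vp, cm, cp, am, bp⟩ := h
  have anti : AntitoneOn (fun t : ℝ => -t) (Icc (-b) (-a)) := fun _ _ _ _ => neg_le_neg
  refine ⟨⟨D, fun x hx => hD _ (neg_mem_Icc_of_mem hx)⟩,
    ⟨C, fun x hx => hC _ (neg_mem_Icc_of_mem hx)⟩,
    ne_top_of_le_ne_top vp (eVariationOn.comp_le_of_antitoneOn wp _ anti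
      fun _ => neg_mem_Icc_of_mem),
    ne_top_of_le_ne_top vm (eVariationOn.comp_le_of_antitoneOn wm _ anti
      fun _ => neg_mem_Icc_of_mem), fun x hx => ?_, fun x hx => ?_, by simpa using bp,
    by simpa using am⟩
  · exact (cp (-x) ⟨le_neg_of_le_neg hx.2, neg_lt_of_neg_lt hx.1⟩).comp
      continuous_neg.continuousWithinAt fun t (ht : t < x) => neg_lt_neg ht
  · exact (cm (-x) ⟨lt_neg_of_lt_neg hx.2, neg_le_of_neg_le hx.1⟩).comp
      continuous_neg.continuousWithinAt fun t (ht : x < t) => neg_lt_neg ht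

theorem demandPotential_comp_neg (a : ℝ) (lm lp : ℝ → ℝ) (μp : Measure ℝ) (x : ℝ) :
    demandPotential (-a) (fun t => lp (-t)) (fun t => lm (-t)) (μp.map Neg.neg) x =
      supplyPotential a lm lp μp (-x) := by
  unfold demandPotential supplyPotential
  rw [setIntegral_Ico_map_neg μp (fun t => (lm t)⁻¹ * (lp t)⁻¹ ^ 2), neg_neg]

namespace IsMarket

variable {a b : ℝ} {lm lp : ℝ → ℝ} {μm μp : Measure ℝ}

theorem comp_neg (M : IsMarket a b lm lp μm μp) :
    IsMarket (-b) (-a) (fun t => lp (-t)) (fun t => lm (-t)) (μp.map Neg.neg)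
      (μm.map Neg.neg) where
  lt := neg_lt_neg M.lt
  cont_demand := M.cont_supply.comp continuous_neg.continuousOn fun _ => neg_mem_Icc_of_mem
  cont_supply := M.cont_demand.comp continuous_neg.continuousOn fun _ => neg_mem_Icc_of_mem
  anti _ hx _ hy hxy := M.mono (neg_mem_Icc_of_mem hy) (neg_mem_Icc_of_mem hx) (neg_le_neg hxy)
  mono _ hx _ hy hxy := M.anti (neg_mem_Icc_of_mem hy) (neg_mem_Icc_of_mem hx) (neg_le_neg hxy)
  demand_pos _ hx := M.supply_pos _ (neg_mem_Icc_of_mem hx)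
  supply_pos _ hx := M.demand_pos _ (neg_mem_Icc_of_mem hx)
  finite_demand := have := M.finite_supply; inferInstance
  finite_supply := have := M.finite_demand; inferInstance
  demand_Ico x hx y hy hxy := by
    rw [measureReal_def, Measure.map_apply measurable_neg measurableSet_Ico, ← measureReal_def,
      ← M.supply_Ioc _ (neg_mem_Icc_of_mem hy) _ (neg_mem_Icc_of_mem hx) (neg_le_neg hxy)]
    simp
  supply_Ioc x hx y hy hxy := by
    rw [measureReal_def, Measure.map_apply measurable_neg measurableSet_Ioc, ← measureReal_def,
      ← M.demand_Ico _ (neg_mem_Icc_of_mem hy) _ (neg_mem_Icc_of_mem hx) (neg_le_neg hxy)]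
    simp

theorem exists_bestOfferGen_eq_ite_le_right (M : IsMarket a b lm lp μm μp) {z θ K : ℝ}
    (hz : z ∈ Icc a b) (hθ : θ = lp z * ((lp a)⁻¹ - K * supplyPotential a lm lp μp z))
    (hK : K * (1 + lm b * lp b * supplyPotential a lm lp μp b) =
      lp b + lm b * lp b * (lp a)⁻¹) :
    ∃ wm wp, WPair a b wm wp ∧ ∀ x ∈ Ico a b, ∀ y ∈ Ioc a b, x < y →
      bestOfferGen a b lm lp μm μp wm wp x y = (if z ≤ y then 1 else 0) - θ := by
  obtain ⟨wm, wp, h, H⟩ := M.comp_neg.exists_bestOfferGen_eq (z := -z) (θ := θ) (K := K)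
    ⟨neg_le_neg hz.2, neg_le_neg hz.1⟩ (by simpa [demandPotential_comp_neg] using hθ)
    (by simpa [demandPotential_comp_neg] using hK)
  refine ⟨fun t => wp (-t), fun t => wm (-t), by simpa using h.comp_neg, fun x hx y hy hxy => ?_⟩
  have := H (-y) ⟨neg_le_neg hy.2, neg_lt_neg hy.1⟩ (-x) ⟨neg_lt_neg hx.2, neg_le_neg hx.1⟩
    (neg_lt_neg hxy)
  have e := bestOfferGen_comp_neg a b lm lp μm μp (fun t => wp (-t)) (fun t => wm (-t)) (-y) (-x)
  simp only [neg_neg] at e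
  simpa [← e] using this

end IsMarket

theorem Mplus_mem {b : ℝ} {X : OrderBook} (h : ∀ x ∈ X.plus, x < b) (h0 : X.plus ≠ 0) :
    Mplus b X ∈ X.plus := by
  have hfin : (insert b {x | x ∈ X.plus}).Finite := (Multiset.finite_toSet X.plus).insert b
  obtain ⟨s, hs⟩ := Multiset.exists_mem_of_ne_zero h0
  have hle : Mplus b X ≤ s := csInf_le hfin.bddBelow (mem_insert_of_mem _ hs)
  exact ((insert_nonempty _ _).csInf_mem hfin).resolve_left (hle.trans_lt (h s hs)).ne

theorem Mminus_mem {a : ℝ} {X : OrderBook} (h : ∀ x ∈ X.minus, a < x) (h0 : X.minus ≠ 0) :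
    Mminus a X ∈ X.minus := by
  have hfin : (insert a {x | x ∈ X.minus}).Finite := (Multiset.finite_toSet X.minus).insert a
  obtain ⟨s, hs⟩ := Multiset.exists_mem_of_ne_zero h0
  have hle : s ≤ Mminus a X := le_csSup hfin.bddAbove (mem_insert_of_mem _ hs)
  exact ((insert_nonempty _ _).csSup_mem hfin).resolve_left ((h s hs).trans_le hle).ne'

theorem Mplus_of_plus_eq_zero {b : ℝ} {X : OrderBook} (h : X.plus = 0) : Mplus b X = b := by
  simp [Mplus, h]

theorem Mminus_of_minus_eq_zero {a : ℝ} {X : OrderBook} (h : X.minus = 0) : Mminus a X = a := by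
  simp [Mminus, h]

namespace IsConfig

variable {a b : ℝ} {X : OrderBook}

theorem Mplus_mem_Ioc (hab : a < b) (h : IsConfig a b X) : Mplus b X ∈ Ioc a b := by
  by_cases h0 : X.plus = 0
  · rw [Mplus_of_plus_eq_zero h0]
    exact ⟨hab, le_rfl⟩
  · have := h.2.1 _ (Mplus_mem (fun x hx => (h.2.1 x hx).2) h0)
    exact ⟨this.1, this.2.le⟩

theorem Mminus_mem_Ico (hab : a < b) (h : IsConfig a b X) : Mminus a X ∈ Ico a b := by
  by_cases h0 : X.minus = 0
  · rw [Mminus_of_minus_eq_zero h0]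
    exact ⟨le_rfl, hab⟩
  · have := h.1 _ (Mminus_mem (fun x hx => (h.1 x hx).1) h0)
    exact ⟨this.1.le, this.2⟩

theorem Mminus_lt_Mplus (hab : a < b) (h : IsConfig a b X) : Mminus a X < Mplus b X := by
  by_cases h0 : X.minus = 0
  · rw [Mminus_of_minus_eq_zero h0]
    exact (h.Mplus_mem_Ioc hab).1
  by_cases h1 : X.plus = 0
  · rw [Mplus_of_plus_eq_zero h1]
    exact (h.Mminus_mem_Ico hab).2
  exact h.2.2 _ (Mminus_mem (fun x hx => (h.1 x hx).1) h0) _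
    (Mplus_mem (fun x hx => (h.2.1 x hx).2) h1)

theorem linF_Lminus_sub (hab : a < b) (h : IsConfig a b X) {wm wp : ℝ → ℝ} (ha : wm a = 0)
    (hb : wp b = 0) {u : ℝ} (hu : u ∈ Icc a b) :
    linF wm wp (Lminus a b u X) - linF wm wp X =
      if Mplus b X ≤ u then -wp (Mplus b X) else wm u := by
  classical
  have hM := h.Mplus_mem_Ioc hab
  by_cases h0 : X.plus = 0
  · have hXb := Mplus_of_plus_eq_zero (b := b) h0
    rcases eq_or_lt_of_le hu.2 with rfl | hub
    · simp [Lminus, h0, hXb, hb]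
    · rcases eq_or_lt_of_le hu.1 with rfl | hau
      · simp [Lminus, h0, hXb, ha, hab.not_ge]
      · simp [Lminus, h0, hXb, hub.not_ge, hau, hub, linF]
  · have hmem := Mplus_mem (fun x hx => (h.2.1 x hx).2) h0
    by_cases hle : Mplus b X ≤ u
    · have := Multiset.sum_map_erase (f := wp) hmem
      simp only [Lminus, ne_eq, h0, not_false_eq_true, hle, and_self, if_true, linF]
      convert_to _ + (((X.plus.erase (Mplus b X)).map wp).sum) - _ = _
      linarith
    · have hub : u < b := (not_le.1 hle).trans_le hM.2
      rcases eq_or_lt_of_le hu.1 with rfl | hau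
      · simp [Lminus, hle, ha]
      · simp [Lminus, hle, hau, hub, linF]

theorem linF_Lplus_sub (hab : a < b) (h : IsConfig a b X) {wm wp : ℝ → ℝ} (ha : wm a = 0)
    (hb : wp b = 0) {u : ℝ} (hu : u ∈ Icc a b) :
    linF wm wp (Lplus a b u X) - linF wm wp X =
      if u ≤ Mminus a X then -wm (Mminus a X) else wp u := by
  classical
  have hM := h.Mminus_mem_Ico hab
  by_cases h0 : X.minus = 0
  · have hXa := Mminus_of_minus_eq_zero (a := a) h0
    rcases eq_or_lt_of_le hu.1 with rfl | hau
    · simp [Lplus, h0, hXa, ha]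
    · rcases eq_or_lt_of_le hu.2 with rfl | hub
      · simp [Lplus, h0, hXa, hb, hab.not_ge]
      · simp [Lplus, h0, hXa, hau.not_ge, hau, hub, linF]
  · have hmem := Mminus_mem (fun x hx => (h.1 x hx).1) h0
    by_cases hle : u ≤ Mminus a X
    · have := Multiset.sum_map_erase (f := wm) hmem
      simp only [Lplus, ne_eq, h0, not_false_eq_true, hle, and_self, if_true, linF]
      convert_to (((X.minus.erase (Mminus a X)).map wm).sum) + _ - _ = _
      linarith
    · have hau : a < u := hM.1.trans_lt (not_le.1 hle)
      rcases eq_or_lt_of_le hu.2 with rfl | hub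
      · simp [Lplus, hle, hb]
      · simp [Lplus, hle, hau, hub, linF]

end IsConfig

theorem exists_isConfig {a b x y : ℝ} (hx : x ∈ Ico a b) (hy : y ∈ Ioc a b) (hxy : x < y) :
    ∃ X, IsConfig a b X ∧ Mminus a X = x ∧ Mplus b X = y := by
  classical
  refine ⟨⟨if a < x then {x} else 0, if y < b then {y} else 0⟩, ⟨?_, ?_, ?_⟩, ?_, ?_⟩
  · intro t ht
    dsimp only at ht
    split_ifs at ht with h
    · rw [Multiset.mem_singleton.1 ht]
      exact ⟨h, hx.2⟩
    · simp at ht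
  · intro t ht
    dsimp only at ht
    split_ifs at ht with h
    · rw [Multiset.mem_singleton.1 ht]
      exact ⟨hy.1, h⟩
    · simp at ht
  · intro s hs t ht
    dsimp only at hs ht
    split_ifs at hs ht <;> simp_all
  · by_cases h : a < x
    · simp only [Mminus, h, if_true, Multiset.mem_singleton, ofPred_eq_eq_singleton, csSup_pair]
      exact max_eq_right h.le
    · rw [Mminus_of_minus_eq_zero (by simp [h])]
      exact le_antisymm hx.1 (not_lt.1 h)
  · by_cases h : y < b
    · simp only [Mplus, h, if_true, Multiset.mem_singleton, ofPred_eq_eq_singleton, csInf_pair]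
      exact min_eq_right h.le
    · rw [Mplus_of_plus_eq_zero (by simp [h])]
      exact le_antisymm (not_lt.1 h) hy.2

theorem integral_eq_setIntegral_Icc {a b : ℝ} {ρ : Measure ℝ} (hρ : ρ (Icc a b)ᶜ = 0)
    (f : ℝ → ℝ) : ∫ u, f u ∂ρ = ∫ u in Icc a b, f u ∂ρ := by
  have h : ∀ᵐ u ∂ρ, u ∈ Icc a b := mem_ae_iff.2 hρ
  rw [Measure.restrict_eq_self_of_ae_mem h]

namespace IsMarket

variable {a b : ℝ} {lm lp : ℝ → ℝ} {μm μp : Measure ℝ}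

theorem genOp_linF_eq (M : IsMarket a b lm lp μm μp) (hμm : IsMuMinus a b lm μm)
    (hμp : IsMuPlus a b lp μp) {wm wp : ℝ → ℝ} (hw : WPair a b wm wp) {X : OrderBook}
    (hX : IsConfig a b X) :
    genOp a b μm μp (linF wm wp) X =
      bestOfferGen a b lm lp μm μp wm wp (Mminus a X) (Mplus b X) := by
  have := M.finite_demand
  have := M.finite_supply
  obtain ⟨-, -, vm, vp, -, -, am, bp⟩ := hw
  have hx := hX.Mminus_mem_Ico M.lt
  have hy := hX.Mplus_mem_Ioc M.lt
  unfold genOp bestOfferGen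
  rw [integral_eq_setIntegral_Icc hμm.2, integral_eq_setIntegral_Icc hμp.2,
    setIntegral_congr_fun measurableSet_Icc fun u hu => hX.linF_Lminus_sub M.lt am bp hu,
    setIntegral_congr_fun measurableSet_Icc fun u hu => hX.linF_Lplus_sub M.lt am bp hu]
  set x := Mminus a X
  set y := Mplus b X
  have e1 : EqOn (fun u => if y ≤ u then -wp y else wm u) wm (Ico a y) :=
    fun u hu => if_neg hu.2.not_ge
  have e2 : EqOn (fun u => if y ≤ u then -wp y else wm u) (fun _ => -wp y) (Icc y b) :=
    fun u hu => if_pos hu.1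
  have e3 : EqOn (fun u => if u ≤ x then -wm x else wp u) (fun _ => -wm x) (Icc a x) :=
    fun u hu => if_pos hu.2
  have e4 : EqOn (fun u => if u ≤ x then -wm x else wp u) wp (Ioc x b) :=
    fun u hu => if_neg hu.1.not_ge
  have i1 : IntegrableOn wm (Ico a y) μm :=
    (vm.integrableOn_Icc μm).mono_set fun t ht => ⟨ht.1, ht.2.le.trans hy.2⟩
  have i4 : IntegrableOn wp (Ioc x b) μp :=
    (vp.integrableOn_Icc μp).mono_set fun t ht => ⟨hx.1.trans ht.1.le, ht.2⟩
  have d1 : Disjoint (Ico a y) (Icc y b) :=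
    disjoint_left.2 fun t ht ht' => ht.2.not_ge ht'.1
  have d2 : Disjoint (Icc a x) (Ioc x b) :=
    disjoint_left.2 fun t ht ht' => ht.2.not_gt ht'.1
  have m1 : μm.real (Icc y b) = lm y := by
    rw [measureReal_def, hμm.1 y ⟨hy.1.le, hy.2⟩,
      ENNReal.toReal_ofReal (M.demand_pos y ⟨hy.1.le, hy.2⟩).le]
  have m2 : μp.real (Icc a x) = lp x := by
    rw [measureReal_def, hμp.1 x ⟨hx.1, hx.2.le⟩,
      ENNReal.toReal_ofReal (M.supply_pos x ⟨hx.1, hx.2.le⟩).le]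
  have i2 : IntegrableOn (fun _ => -wp y) (Icc y b) μm := integrableOn_const (measure_ne_top _ _)
  have i3 : IntegrableOn (fun _ => -wm x) (Icc a x) μp := integrableOn_const (measure_ne_top _ _)
  have I1 : ∫ u in Icc a b, (if y ≤ u then -wp y else wm u) ∂μm =
      (∫ u in Ico a y, wm u ∂μm) - wp y * lm y := by
    rw [← Ico_union_Icc_eq_Icc hy.1.le hy.2, setIntegral_union d1 measurableSet_Icc
      (i1.congr_fun e1.symm measurableSet_Ico) (i2.congr_fun e2.symm measurableSet_Icc),
      setIntegral_congr_fun measurableSet_Ico e1, setIntegral_congr_fun measurableSet_Icc e2,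
      setIntegral_const, m1, smul_eq_mul]
    ring
  have I2 : ∫ u in Icc a b, (if u ≤ x then -wm x else wp u) ∂μp =
      (∫ u in Ioc x b, wp u ∂μp) - wm x * lp x := by
    rw [← Icc_union_Ioc_eq_Icc hx.1 hx.2.le, setIntegral_union d2 measurableSet_Ioc
      (i3.congr_fun e3.symm measurableSet_Icc) (i4.congr_fun e4.symm measurableSet_Ioc),
      setIntegral_congr_fun measurableSet_Icc e3, setIntegral_congr_fun measurableSet_Ioc e4,
      setIntegral_const, m2, smul_eq_mul]
    ring
  rw [I1, I2]

theorem eqOn_of_genOp_linF_eq (M : IsMarket a b lm lp μm μp) (hμm : IsMuMinus a b lm μm)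
    (hμp : IsMuPlus a b lp μp) {wm wp wm' wp' : ℝ → ℝ} (hw : WPair a b wm wp)
    (hw' : WPair a b wm' wp') (H : ∀ X, IsConfig a b X →
      genOp a b μm μp (linF wm' wp') X = genOp a b μm μp (linF wm wp) X) :
    EqOn wm' wm (Icc a b) ∧ EqOn wp' wp (Icc a b) := by
  refine M.eqOn_of_bestOfferGen_eq hw hw' fun x hx y hy hxy => ?_
  obtain ⟨X, hX, rfl, rfl⟩ := exists_isConfig hx hy hxy
  rw [← M.genOp_linF_eq hμm hμp hw hX, ← M.genOp_linF_eq hμm hμp hw' hX, H X hX]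

end IsMarket

theorem isFiniteMeasure_of_compl_Icc {a b : ℝ} {ρ : Measure ℝ} (h : ρ (Icc a b) ≠ ∞)
    (hρ : ρ (Icc a b)ᶜ = 0) : IsFiniteMeasure ρ := by
  refine ⟨?_⟩
  rw [← measure_add_measure_compl (measurableSet_Icc (a := a) (b := b)), hρ, add_zero]
  exact h.lt_top

theorem isMarket_of_isMu {a b : ℝ} (hab : a < b) {lm lp : ℝ → ℝ} (hA3 : A3 a b lm lp)
    (hA6 : A6 a b lm lp) {μm μp : Measure ℝ} (hμm : IsMuMinus a b lm μm)
    (hμp : IsMuPlus a b lp μp) : IsMarket a b lm lp μm μp := by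
  obtain ⟨cm, cp, anti, mono, hm, hp⟩ := hA3
  have ha : a ∈ Icc a b := ⟨le_rfl, hab.le⟩
  have hb : b ∈ Icc a b := ⟨hab.le, le_rfl⟩
  have fm : IsFiniteMeasure μm :=
    isFiniteMeasure_of_compl_Icc (by rw [hμm.1 a ha]; exact ENNReal.ofReal_ne_top) hμm.2
  have fp : IsFiniteMeasure μp :=
    isFiniteMeasure_of_compl_Icc (by rw [hμp.1 b hb]; exact ENNReal.ofReal_ne_top) hμp.2
  have rm : ∀ x ∈ Icc a b, μm.real (Icc x b) = lm x := fun x hx => by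
    rw [measureReal_def, hμm.1 x hx, ENNReal.toReal_ofReal (hm x hx)]
  have rp : ∀ x ∈ Icc a b, μp.real (Icc a x) = lp x := fun x hx => by
    rw [measureReal_def, hμp.1 x hx, ENNReal.toReal_ofReal (hp x hx)]
  refine ⟨hab, cm, cp, anti, mono, fun x hx => hA6.2.trans_le (anti hx hb hx.2),
    fun x hx => hA6.1.trans_le (mono ha hx hx.1), fm, fp, fun x hx y hy hxy => ?_,
    fun x hx y hy hxy => ?_⟩
  · rw [← rm x hx, ← rm y hy, ← Ico_union_Icc_eq_Icc hxy hy.2, measureReal_union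
      (disjoint_left.2 fun t ht ht' => ht.2.not_ge ht'.1) measurableSet_Icc]
    ring
  · rw [← rp x hx, ← rp y hy, ← Icc_union_Ioc_eq_Icc hx.1 hxy, measureReal_union
      (disjoint_left.2 fun t ht ht' => ht.2.not_gt ht'.1) measurableSet_Ioc]
    ring

end WeightFunctions

/-- special weight functions: under (A3) and (A6), with `(fm, fp)` the
unique solution of Luckock's equation, for each `z ∈ [a,b]` there is a unique
admissible pair of weight functions whose associated linear functional `F` satisfies
`GF(X) = 1_{M₋(X) ≤ z} − fm z` for all configurations `X`, and likewise a unique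
admissible pair whose linear functional satisfies `GF(X) = 1_{M₊(X) ≥ z} − fp z`. -/
theorem stmt8 (a b : ℝ) (hab : a < b) (lm lp : ℝ → ℝ)
    (hA3 : A3 a b lm lp) (hA6 : A6 a b lm lp)
    (fm fp : ℝ → ℝ) (hsol : LuckockSol a b lm lp fm fp)
    (μm μp : MeasureTheory.Measure ℝ)
    (hμm : IsMuMinus a b lm μm) (hμp : IsMuPlus a b lp μp)
    (z : ℝ) (hz : z ∈ Set.Icc a b) :
    (∃ wm wp : ℝ → ℝ,
      (WPair a b wm wp ∧
        ∀ X : OrderBook, IsConfig a b X →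
          genOp a b μm μp (linF wm wp) X =
            (if Mminus a X ≤ z then (1 : ℝ) else 0) - fm z) ∧
      ∀ wm' wp' : ℝ → ℝ,
        (WPair a b wm' wp' ∧
          ∀ X : OrderBook, IsConfig a b X →
            genOp a b μm μp (linF wm' wp') X =
              (if Mminus a X ≤ z then (1 : ℝ) else 0) - fm z) →
        Set.EqOn wm' wm (Set.Icc a b) ∧ Set.EqOn wp' wp (Set.Icc a b)) ∧
    (∃ wm wp : ℝ → ℝ,
      (WPair a b wm wp ∧
        ∀ X : OrderBook, IsConfig a b X →
          genOp a b μm μp (linF wm wp) X =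
            (if z ≤ Mplus b X then (1 : ℝ) else 0) - fp z) ∧
      ∀ wm' wp' : ℝ → ℝ,
        (WPair a b wm' wp' ∧
          ∀ X : OrderBook, IsConfig a b X →
            genOp a b μm μp (linF wm' wp') X =
              (if z ≤ Mplus b X then (1 : ℝ) else 0) - fp z) →
        Set.EqOn wm' wm (Set.Icc a b) ∧ Set.EqOn wp' wp (Set.Icc a b)) := by
  have M := isMarket_of_isMu hab hA3 hA6 hμm hμp
  obtain ⟨K, h1, h2, h3⟩ := M.exists_luckockSol_eq hsol
  obtain ⟨wm, wp, hw, H⟩ := M.exists_bestOfferGen_eq hz (h3 z hz).1 h1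
  obtain ⟨vm, vp, hv, H'⟩ := M.exists_bestOfferGen_eq_ite_le_right hz (h3 z hz).2 h2
  have G : ∀ X, IsConfig a b X → genOp a b μm μp (linF wm wp) X =
      (if Mminus a X ≤ z then (1 : ℝ) else 0) - fm z := fun X hX => by
    rw [M.genOp_linF_eq hμm hμp hw hX]
    exact H _ (hX.Mminus_mem_Ico hab) _ (hX.Mplus_mem_Ioc hab) (hX.Mminus_lt_Mplus hab)
  have G' : ∀ X, IsConfig a b X → genOp a b μm μp (linF vm vp) X =
      (if z ≤ Mplus b X then (1 : ℝ) else 0) - fp z := fun X hX => by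
    rw [M.genOp_linF_eq hμm hμp hv hX]
    exact H' _ (hX.Mminus_mem_Ico hab) _ (hX.Mplus_mem_Ioc hab) (hX.Mminus_lt_Mplus hab)
  exact ⟨⟨wm, wp, ⟨hw, G⟩, fun _ _ h => M.eqOn_of_genOp_linF_eq hμm hμp hw h.1 fun X hX =>
      (h.2 X hX).trans (G X hX).symm⟩,
    ⟨vm, vp, ⟨hv, G'⟩, fun _ _ h => M.eqOn_of_genOp_linF_eq hμm hμp hv h.1 fun X hX =>
      (h.2 X hX).trans (G' X hX).symm⟩⟩
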